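/- Let γ : [0,T] → closure(ℍ) be a continuous injective curve with γ(0) ∈ ℝ and γ(t) ∈ ℍ for all t ∈ (0,T], and suppose K_t := γ((0,t]) is a geometric Loewner chain (so each K_t is a half-plane hull and hcap(K_t) = 2t) driven by a continuous function λ : [0,T] → ℝ. If ℍ \ K_T is a (β,C₀)-Hölder domain, then there is a constant C > 0 depending only on β, C₀ and T such that |λ(s) − λ(t)| ≤ C·√(|s−t|·log(1/|s−t|)) for all s,t ∈ [0,T] with 0 < |s−t| ≤ 1/2. -/

import Mathlib

open Set Metric Filter Bornology Complex Function

noncomputable section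

/-- The upper half-plane as a subset of `ℂ`. -/
def UHP : Set ℂ := {z : ℂ | 0 < z.im}

/-- `K` is a half-plane hull: a bounded subset of the upper half-plane whose
complement in the upper half-plane is a simply connected domain. -/
def IsHull (K : Set ℂ) : Prop :=
  IsBounded K ∧ K ⊆ UHP ∧ IsOpen (UHP \ K) ∧ IsConnected (UHP \ K) ∧
    SimplyConnectedSpace ↥(UHP \ K)

/-- `f` is the hydrodynamic conformal map of the hull `K`: a conformal bijection
from the upper half-plane onto `UHP \ K` with `f z - z → 0` as `|z| → ∞` in `UHP`. -/
def IsHydroMap (K : Set ℂ) (f : ℂ → ℂ) : Prop :=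
  DifferentiableOn ℂ f UHP ∧ InjOn f UHP ∧ f '' UHP = UHP \ K ∧
    Tendsto (fun z => f z - z) (cobounded ℂ ⊓ 𝓟 UHP) (nhds (0 : ℂ))

/-- `f` is the hydrodynamic map of `K` and `g` is its inverse. -/
def IsHydroPair (K : Set ℂ) (f g : ℂ → ℂ) : Prop :=
  IsHydroMap K f ∧ InvOn g f UHP (UHP \ K)

/-- `K` has half-plane capacity `a`, computed via its hydrodynamic map `f`:
`z * (z - f z) → a` as `|z| → ∞` in `UHP`. -/
def HasHcap (K : Set ℂ) (f : ℂ → ℂ) (a : ℝ) : Prop :=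
  Tendsto (fun z => z * (z - f z)) (cobounded ℂ ⊓ 𝓟 UHP) (nhds (a : ℂ))

/-- The `(β, C₀)`-Hölder condition for a map defined on the upper half-plane. -/
def IsHolder (f : ℂ → ℂ) (β C₀ : ℝ) : Prop :=
  ∀ z ∈ UHP, ∀ z' ∈ UHP, dist (f z) (f z') ≤ C₀ * max (dist z z' ^ β) (dist z z')

/-- The Poincaré hyperbolic distance on the upper half-plane. -/
def rhoH (z w : ℂ) : ℝ :=
  2 * Real.arsinh (dist z w / (2 * Real.sqrt (z.im * w.im)))

/-- The hyperbolic distance on a simply connected domain `Ω`, transported through a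
conformal bijection `φ : UHP → Ω` (independent of the choice of `φ`). -/
def rhoVia (φ : ℂ → ℂ) (z w : ℂ) : ℝ :=
  rhoH (invFunOn φ UHP z) (invFunOn φ UHP w)

/-- `log⁺ x = max (log x) 0`. -/
def posLog (x : ℝ) : ℝ := max (Real.log x) 0

/-- Internal distance between `A` and `B` inside `Ω`: the infimum of diameters of
connected subsets of `Ω` meeting both `A` and `B`. -/
def distIn (Ω A B : Set ℂ) : ℝ :=
  sInf {d : ℝ | ∃ E : Set ℂ, E ⊆ Ω ∧ IsConnected E ∧ (E ∩ A).Nonempty ∧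
    (E ∩ B).Nonempty ∧ d = Metric.diam E}

/-- Internal diameter of `A` inside `Ω`. -/
def diamIn (Ω A : Set ℂ) : ℝ :=
  sSup {d : ℝ | ∃ a ∈ A, ∃ b ∈ A, d = distIn Ω {a} {b}}

/-- An `L`-John curve in `Ω` with tip `z`, parametrized on `[0,1)` (the base-point,
which is not required to lie in `Ω`, corresponds to the missing endpoint). -/
def IsJohnCurve (Ω : Set ℂ) (L : ℝ) (α : ℝ → ℂ) (z : ℂ) : Prop :=
  ContinuousOn α (Ico 0 1) ∧ InjOn α (Ico 0 1) ∧ α 0 = z ∧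
    MapsTo α (Ico 0 1) Ω ∧
    ∀ t ∈ Ico (0:ℝ) 1, Metric.diam (α '' Icc 0 t) ≤ L * infDist (α t) (frontier Ω)

/-- An `L`-John curve in `Ω` with tip `z` and base-point `∞`, parametrized on `[0,∞)`. -/
def IsJohnCurveInfty (Ω : Set ℂ) (L : ℝ) (α : ℝ → ℂ) (z : ℂ) : Prop :=
  ContinuousOn α (Ici 0) ∧ InjOn α (Ici 0) ∧ α 0 = z ∧
    MapsTo α (Ici 0) Ω ∧ Tendsto α atTop (cobounded ℂ) ∧
    ∀ t ∈ Ici (0:ℝ), Metric.diam (α '' Icc 0 t) ≤ L * infDist (α t) (frontier Ω)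


/-- A solution of the Loewner equation in the upper half-plane on `S`. -/
def FlowOn (z : ℝ → ℂ) (lam : ℝ → ℝ) (S : Set ℝ) : Prop :=
  ∀ u ∈ S, 0 < (z u).im ∧ HasDerivAt z (2 / (z u - (lam u : ℂ))) u

lemma FlowOn.mono {z : ℝ → ℂ} {lam : ℝ → ℝ} {S S' : Set ℝ} (h : FlowOn z lam S)
    (hS : S' ⊆ S) : FlowOn z lam S' := fun u hu => h u (hS hu)

lemma FlowOn.contOn {z : ℝ → ℂ} {lam : ℝ → ℝ} {S : Set ℝ} (h : FlowOn z lam S) :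
    ContinuousOn z S := fun u hu => (h u hu).2.continuousAt.continuousWithinAt

lemma FlowOn.hasDerivAt_re {z : ℝ → ℂ} {lam : ℝ → ℝ} {S : Set ℝ} (h : FlowOn z lam S)
    {u : ℝ} (hu : u ∈ S) : HasDerivAt (fun u => (z u).re)
      (2 * ((z u).re - lam u) / (((z u).re - lam u) ^ 2 + (z u).im ^ 2)) u := by
  have h1 : HasDerivAt (fun u => (z u).re) (2 / (z u - (lam u : ℂ))).re u :=
    (Complex.reCLM.hasFDerivAt (x := z u)).comp_hasDerivAt u (h u hu).2
  refine h1.congr_deriv ?_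
  simp [Complex.div_re, Complex.normSq_apply]
  ring

lemma FlowOn.hasDerivAt_im {z : ℝ → ℂ} {lam : ℝ → ℝ} {S : Set ℝ} (h : FlowOn z lam S)
    {u : ℝ} (hu : u ∈ S) : HasDerivAt (fun u => (z u).im)
      (-(2 * (z u).im / (((z u).re - lam u) ^ 2 + (z u).im ^ 2))) u := by
  have h1 : HasDerivAt (fun u => (z u).im) (2 / (z u - (lam u : ℂ))).im u :=
    (Complex.imCLM.hasFDerivAt (x := z u)).comp_hasDerivAt u (h u hu).2
  refine h1.congr_deriv ?_
  simp [Complex.div_im, Complex.normSq_apply]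
  ring

lemma antitoneOn_of_hasDerivAt {φ φ' : ℝ → ℝ} {a b : ℝ}
    (h : ∀ u ∈ Icc a b, HasDerivAt φ (φ' u) u) (h0 : ∀ u ∈ Icc a b, φ' u ≤ 0) :
    AntitoneOn φ (Icc a b) := by
  apply antitoneOn_of_deriv_nonpos (convex_Icc a b)
  · exact fun u hu => (h u hu).continuousAt.continuousWithinAt
  · exact fun u hu => (h u (interior_subset hu)).differentiableAt.differentiableWithinAt
  · intro u hu
    rw [(h u (interior_subset hu)).deriv]
    exact h0 u (interior_subset hu)

lemma FlowOn.im_anti {z : ℝ → ℂ} {lam : ℝ → ℝ} {a b : ℝ} (h : FlowOn z lam (Icc a b)) :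
    AntitoneOn (fun u => (z u).im) (Icc a b) := by
  apply antitoneOn_of_hasDerivAt (fun u hu => h.hasDerivAt_im hu)
  intro u hu
  have := (h u hu).1
  have : 0 ≤ (2 * (z u).im / (((z u).re - lam u) ^ 2 + (z u).im ^ 2)) := by positivity
  linarith

lemma FlowOn.im_sq {z : ℝ → ℂ} {lam : ℝ → ℝ} {a b : ℝ} (hab : a ≤ b)
    (h : FlowOn z lam (Icc a b)) :
    (z a).im ^ 2 ≤ (z b).im ^ 2 + 4 * (b - a) := by
  have key : AntitoneOn (fun u => -((z u).im ^ 2 + 4 * u)) (Icc a b) := by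
    apply antitoneOn_of_hasDerivAt
      (fun u hu => (((h.hasDerivAt_im hu).pow 2).add ((hasDerivAt_id u).const_mul 4)).neg)
    intro u hu
    have h0 := (h u hu).1
    have : (z u).im ^ 2 / (((z u).re - lam u) ^ 2 + (z u).im ^ 2) ≤ 1 := by
      rw [div_le_one (by positivity)]; nlinarith [sq_nonneg ((z u).re - lam u)]
    have e : (2:ℝ) * (z u).im * -(2 * (z u).im / (((z u).re - lam u) ^ 2 + (z u).im ^ 2)) =
      -4 * ((z u).im ^ 2 / (((z u).re - lam u) ^ 2 + (z u).im ^ 2)) := by ring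
    simp only [Nat.cast_ofNat, pow_one, mul_one, Nat.add_one_sub_one]
    linarith
  have := key (left_mem_Icc.2 hab) (right_mem_Icc.2 hab) hab
  simp only at this
  linarith

lemma FlowOn.re_le {z : ℝ → ℂ} {lam : ℝ → ℝ} {a b B : ℝ} (hab : a ≤ b)
    (h : FlowOn z lam (Icc a b)) (hl : ∀ u ∈ Icc a b, lam u ≤ B) (hb : (z b).re ≤ B) :
    (z a).re ≤ B := by
  by_contra hcon
  push Not at hcon
  have hc : ContinuousOn (fun u => (z u).re) (Icc a b) :=
    Complex.continuous_re.comp_continuousOn h.contOn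
  -- the last time at which the real part is at least `re (z a)`
  set S : Set ℝ := Icc a b ∩ (fun u => (z u).re) ⁻¹' Ici (z a).re with hS
  have hSc : IsCompact S :=
    isCompact_Icc.of_isClosed_subset (hc.preimage_isClosed_of_isClosed isClosed_Icc isClosed_Ici)
      inter_subset_left
  have haS : a ∈ S := ⟨left_mem_Icc.2 hab, by simp⟩
  obtain ⟨m, hmS, hm⟩ := hSc.exists_isGreatest ⟨a, haS⟩
  have hm2 : (z a).re ≤ (z m).re := hmS.2
  have hmb : m < b := by
    rcases lt_or_eq_of_le hmS.1.2 with h1 | h1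
    · exact h1
    · subst h1; linarith
  have hd := h.hasDerivAt_re hmS.1
  have hpos : 0 < 2 * ((z m).re - lam m) / (((z m).re - lam m) ^ 2 + (z m).im ^ 2) := by
    have := hl m hmS.1
    have h3 : 0 < (z m).re - lam m := by linarith
    have := (h m hmS.1).1
    positivity
  have hev : ∀ᶠ u in nhdsWithin m (Ioi m), (z m).re < (z u).re := by
    have h1 := (hasDerivAt_iff_tendsto_slope.1 hd).mono_left
      (nhdsWithin_mono m (fun u hu => (ne_of_gt hu : u ≠ m)) : nhdsWithin m (Ioi m) ≤ _)
    have h2 := h1.eventually (lt_mem_nhds hpos)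
    filter_upwards [h2, self_mem_nhdsWithin] with u hu hmu
    rw [slope_def_field] at hu
    have : 0 < u - m := sub_pos.2 hmu
    have := (div_pos_iff_of_pos_right this).1 hu
    linarith
  have hev2 : ∀ᶠ u in nhdsWithin m (Ioi m), u < b :=
    (eventually_lt_nhds hmb).filter_mono nhdsWithin_le_nhds
  obtain ⟨u, hu1, hu2, hu3⟩ := (hev.and (hev2.and self_mem_nhdsWithin)).exists
  have hu3 : m < u := hu3
  have : u ∈ S := ⟨⟨by linarith [hmS.1.1], hu2.le⟩, by show (z a).re ≤ (z u).re; linarith⟩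
  exact absurd (hm this) (by linarith)

lemma FlowOn.neg_conj {z : ℝ → ℂ} {lam : ℝ → ℝ} {S : Set ℝ} (h : FlowOn z lam S) :
    FlowOn (fun u => -(starRingEnd ℂ) (z u)) (fun u => -lam u) S := by
  intro u hu
  refine ⟨by simpa using (h u hu).1, ?_⟩
  have h1 : HasDerivAt (fun u => (starRingEnd ℂ) (z u))
      ((starRingEnd ℂ) (2 / (z u - (lam u : ℂ)))) u :=
    (Complex.conjCLE.hasFDerivAt (x := z u)).comp_hasDerivAt u (h u hu).2
  refine h1.fun_neg.congr_deriv ?_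
  rw [map_div₀, map_sub, Complex.conj_ofReal, ← div_neg, map_ofNat]
  push_cast
  simp
  ring_nf

lemma FlowOn.le_re {z : ℝ → ℂ} {lam : ℝ → ℝ} {a b B : ℝ} (hab : a ≤ b)
    (h : FlowOn z lam (Icc a b)) (hl : ∀ u ∈ Icc a b, B ≤ lam u) (hb : B ≤ (z b).re) :
    B ≤ (z a).re := by
  have := h.neg_conj.re_le (B := -B) hab (fun u hu => by simpa using hl u hu) (by simpa using hb)
  simpa using this

lemma FlowOn.diff {z z' : ℝ → ℂ} {lam : ℝ → ℝ} {a b : ℝ} (hab : a ≤ b)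
    (h : FlowOn z lam (Icc a b)) (h' : FlowOn z' lam (Icc a b)) :
    ‖z b - z' b‖ ^ 2 * ((z b).im * (z' b).im) ≤ ‖z a - z' a‖ ^ 2 * ((z a).im * (z' a).im) := by
  have key : AntitoneOn (fun u => (((z u).re - (z' u).re) ^ 2 + ((z u).im - (z' u).im) ^ 2) *
      ((z u).im * (z' u).im)) (Icc a b) := by
    apply antitoneOn_of_hasDerivAt (fun u hu =>
      ((((h.hasDerivAt_re hu).sub (h'.hasDerivAt_re hu)).pow 2).add
        (((h.hasDerivAt_im hu).sub (h'.hasDerivAt_im hu)).pow 2)).mul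
        ((h.hasDerivAt_im hu).mul (h'.hasDerivAt_im hu)))
    intro u hu
    have h0 := (h u hu).1
    have h0' := (h' u hu).1
    simp only [Nat.cast_ofNat, pow_one, Nat.add_one_sub_one, Pi.sub_apply, Pi.mul_apply, Pi.pow_apply, Pi.add_apply]
    obtain ⟨p, hp⟩ : ∃ p, p = (z u).re - lam u := ⟨_, rfl⟩
    obtain ⟨p', hp'⟩ : ∃ p', p' = (z' u).re - lam u := ⟨_, rfl⟩
    have e : (z u).re - (z' u).re = p - p' := by rw [hp, hp']; ring
    rw [e, ← hp, ← hp']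
    generalize (z u).im = y at *
    generalize (z' u).im = y' at *
    have hn : 0 < p ^ 2 + y ^ 2 := by positivity
    have hn' : 0 < p' ^ 2 + y' ^ 2 := by positivity
    have : 0 ≤ 2 * (((p - p') ^ 2 + (y - y') ^ 2) * (y * y')) *
      ((p / (p ^ 2 + y ^ 2) + p' / (p' ^ 2 + y' ^ 2)) ^ 2 +
        (y' / (p' ^ 2 + y' ^ 2) - y / (p ^ 2 + y ^ 2)) ^ 2) := by positivity
    refine le_of_eq_of_le ?_ (neg_nonpos.2 this)
    field_simp
    ring
  have e : ∀ w : ℂ, ‖w‖ ^ 2 = w.re ^ 2 + w.im ^ 2 := fun w => by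
    rw [Complex.sq_norm, Complex.normSq_apply]; ring
  have := key (left_mem_Icc.2 hab) (right_mem_Icc.2 hab) hab
  simpa [e] using this

/-- The part of the hypotheses that is used in the proof. -/
structure LC (T : ℝ) (γ : ℝ → ℂ) (f g : ℝ → ℂ → ℂ) (lam : ℝ → ℝ) : Prop where
  γc : ContinuousOn γ (Icc 0 T)
  γU : ∀ t ∈ Ioc (0:ℝ) T, γ t ∈ UHP
  γi : InjOn γ (Icc 0 T)
  fd : ∀ t ∈ Icc (0:ℝ) T, DifferentiableOn ℂ (f t) UHP
  fU : ∀ t ∈ Icc (0:ℝ) T, ∀ z ∈ UHP, f t z ∈ UHP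
  fK : ∀ t ∈ Icc (0:ℝ) T, ∀ z ∈ UHP, f t z ∉ γ '' Ioc 0 t
  gU : ∀ t ∈ Icc (0:ℝ) T, ∀ w ∈ UHP, w ∉ γ '' Ioc 0 t → g t w ∈ UHP
  fg : ∀ t ∈ Icc (0:ℝ) T, ∀ w ∈ UHP, w ∉ γ '' Ioc 0 t → f t (g t w) = w
  gf : ∀ t ∈ Icc (0:ℝ) T, ∀ z ∈ UHP, g t (f t z) = z
  lc : ContinuousOn lam (Icc 0 T)
  ode : ∀ z ∈ UHP, ∀ t ∈ Icc (0:ℝ) T, z ∉ γ '' Ioc 0 t →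
        HasDerivAt (fun s : ℝ => g s z) (2 / (g t z - (lam t : ℂ))) t
  g0 : ∀ w ∈ UHP, g 0 w = w

lemma isOpen_UHP : IsOpen UHP := isOpen_lt continuous_const Complex.continuous_im

section
variable {T : ℝ} {γ : ℝ → ℂ} {f g : ℝ → ℂ → ℂ} {lam : ℝ → ℝ}

lemma LC.notMem_mono {w : ℂ} {a b : ℝ} (hab : a ≤ b)
    (hw : w ∉ γ '' Ioc 0 b) : w ∉ γ '' Ioc 0 a :=
  fun h => hw (image_mono (Ioc_subset_Ioc_right hab) h)

/-- The trajectory of a point which is not swallowed before time `b`. -/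
lemma LC.flow (h : LC T γ f g lam) {w : ℂ} (hw : w ∈ UHP) {b : ℝ}
    (hb : b ≤ T) (hwb : w ∉ γ '' Ioc 0 b) : FlowOn (fun u => g u w) lam (Icc 0 b) := by
  intro u hu
  have hu' : u ∈ Icc (0:ℝ) T := ⟨hu.1, hu.2.trans hb⟩
  have := LC.notMem_mono hu.2 hwb
  exact ⟨h.gU u hu' w hw this, h.ode w hw u hu' this⟩

/-- A curve point is not in the earlier hulls. -/
lemma LC.tip_notMem (h : LC T γ f g lam) {u τ : ℝ} (hu : u < τ) (hτ : τ ∈ Ioc 0 T) :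
    γ τ ∉ γ '' Ioc 0 u := by
  rintro ⟨v, hv, hvτ⟩
  have := h.γi ⟨hv.1.le, by linarith [hv.2, hτ.2]⟩ ⟨hτ.1.le, hτ.2⟩ hvτ
  linarith [hv.2]

lemma LC.tip_flow (h : LC T γ f g lam) {τ : ℝ} (hτ : τ ∈ Ioc 0 T) :
    FlowOn (fun u => g u (γ τ)) lam (Ico 0 τ) := by
  intro u hu
  exact h.flow (h.γU τ hτ) (hu.2.le.trans hτ.2) (h.tip_notMem hu.2 hτ) u ⟨hu.1, le_rfl⟩

/-- The lower distortion bound. -/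
lemma LC.lower (h : LC T γ f g lam) {s : ℝ} (hs : s ∈ Icc 0 T) {z z' : ℂ} (hz : z ∈ UHP)
    (hz' : z' ∈ UHP) : ‖z - z'‖ ^ 2 * (z.im * z'.im) ≤
      ‖f s z - f s z'‖ ^ 2 * ((f s z).im * (f s z').im) := by
  have h1 := h.flow (h.fU s hs z hz) hs.2 (h.fK s hs z hz)
  have h2 := h.flow (h.fU s hs z' hz') hs.2 (h.fK s hs z' hz')
  have := h1.diff hs.1 h2
  simpa [h.gf s hs z hz, h.gf s hs z' hz', h.g0 _ (h.fU s hs z hz),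
    h.g0 _ (h.fU s hs z' hz')] using this

lemma LC.f_im_sq (h : LC T γ f g lam) {s : ℝ} (hs : s ∈ Icc 0 T) {z : ℂ} (hz : z ∈ UHP) :
    (f s z).im ^ 2 ≤ z.im ^ 2 + 4 * s := by
  have h1 := (h.flow (h.fU s hs z hz) hs.2 (h.fK s hs z hz)).im_sq hs.1
  simpa [h.gf s hs z hz, h.g0 _ (h.fU s hs z hz)] using h1

lemma LC.f_re_le (h : LC T γ f g lam) {s B : ℝ} (hs : s ∈ Icc 0 T) {z : ℂ} (hz : z ∈ UHP)
    (hl : ∀ u ∈ Icc 0 s, lam u ≤ B) (hb : z.re ≤ B) : (f s z).re ≤ B := by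
  have h1 := (h.flow (h.fU s hs z hz) hs.2 (h.fK s hs z hz)).re_le hs.1 hl
    (by simpa [h.gf s hs z hz] using hb)
  simpa [h.gf s hs z hz, h.g0 _ (h.fU s hs z hz)] using h1

lemma LC.le_f_re (h : LC T γ f g lam) {s B : ℝ} (hs : s ∈ Icc 0 T) {z : ℂ} (hz : z ∈ UHP)
    (hl : ∀ u ∈ Icc 0 s, B ≤ lam u) (hb : B ≤ z.re) : B ≤ (f s z).re := by
  have h1 := (h.flow (h.fU s hs z hz) hs.2 (h.fK s hs z hz)).le_re hs.1 hl
    (by simpa [h.gf s hs z hz] using hb)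
  simpa [h.gf s hs z hz, h.g0 _ (h.fU s hs z hz)] using h1

lemma LC.f_deriv_ne (h : LC T γ f g lam) {s : ℝ} (hs : s ∈ Icc 0 T) {z : ℂ} (hz : z ∈ UHP) :
    deriv (f s) z ≠ 0 := by
  intro h0
  have hd : HasDerivAt (f s) 0 z := by
    rw [← h0]
    exact ((h.fd s hs).differentiableAt (isOpen_UHP.mem_nhds hz)).hasDerivAt
  have hz0 : 0 < z.im := hz
  have hY : 0 < (f s z).im := h.fU s hs z hz
  have h1 := (hasDerivAt_iff_isLittleO.1 hd).bound (c := z.im / (4 * (f s z).im)) (by positivity)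
  have h2 : ∀ᶠ z' in nhds z, z.im / 2 < z'.im :=
    Complex.continuous_im.continuousAt.eventually (lt_mem_nhds (by linarith))
  have h3 : ∀ᶠ z' in nhds z, (f s z').im < 2 * (f s z).im :=
    (Complex.continuous_im.continuousAt.comp hd.continuousAt).eventually
      (gt_mem_nhds (by simp; linarith))
  have h4 : ∀ᶠ z' in nhdsWithin z {z}ᶜ, z' ≠ z := self_mem_nhdsWithin
  obtain ⟨z', ⟨h1, h2, h3⟩, h4⟩ :=
    (((h1.and (h2.and h3)).filter_mono nhdsWithin_le_nhds).and h4).exists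
  have hz' : z' ∈ UHP := by show 0 < z'.im; linarith
  have hl := h.lower hs hz' hz
  simp only [smul_zero, sub_zero] at h1
  have hn : 0 < ‖z' - z‖ := norm_pos_iff.2 (sub_ne_zero.2 h4)
  have h5 : ‖f s z' - f s z‖ ^ 2 ≤ (z.im / (4 * (f s z).im) * ‖z' - z‖) ^ 2 := by gcongr
  have h6 : ‖f s z' - f s z‖ ^ 2 * ((f s z').im * (f s z).im) ≤
      (z.im / (4 * (f s z).im) * ‖z' - z‖) ^ 2 * (2 * (f s z).im * (f s z).im) := by
    have : 0 < (f s z').im := h.fU s hs z' hz'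
    gcongr
  have h7 : (z.im / (4 * (f s z).im) * ‖z' - z‖) ^ 2 * (2 * (f s z).im * (f s z).im) =
      ‖z' - z‖ ^ 2 * (z.im * z.im) / 8 := by field_simp; ring
  have h8 : ‖z' - z‖ ^ 2 * (z.im / 2 * z.im) ≤ ‖z' - z‖ ^ 2 * (z'.im * z.im) := by gcongr
  have h9 : 0 < ‖z' - z‖ ^ 2 * (z.im * z.im) := by positivity
  linarith

lemma LC.f_strict (h : LC T γ f g lam) {s : ℝ} (hs : s ∈ Icc 0 T) {z : ℂ} (hz : z ∈ UHP) :
    HasStrictDerivAt (f s) (deriv (f s) z) z :=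
  ((h.fd s hs).analyticAt (isOpen_UHP.mem_nhds hz)).hasStrictDerivAt

lemma LC.g_contAt (h : LC T γ f g lam) {s : ℝ} (hs : s ∈ Icc 0 T) {w : ℂ} (hw : w ∈ UHP)
    (hwK : w ∉ γ '' Ioc 0 s) : ContinuousAt (g s) w := by
  have hz := h.gU s hs w hw hwK
  have e := (h.f_strict hs hz).map_nhds_eq (h.f_deriv_ne hs hz)
  rw [h.fg s hs w hw hwK] at e
  rw [ContinuousAt, ← e, tendsto_map'_iff]
  refine tendsto_id.congr' ?_
  filter_upwards [isOpen_UHP.mem_nhds hz] with z' hz'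
  simp [h.gf s hs z' hz']

lemma LC.g_diffAt (h : LC T γ f g lam) {s : ℝ} (hs : s ∈ Icc 0 T)
    {w : ℂ} (hw : w ∈ UHP) (hwK : w ∉ γ '' Ioc 0 s) : DifferentiableAt ℂ (g s) w := by
  have hz := h.gU s hs w hw hwK
  have e := (h.f_strict hs hz).map_nhds_eq (h.f_deriv_ne hs hz)
  rw [h.fg s hs w hw hwK] at e
  refine (HasDerivAt.of_local_left_inverse (h.g_contAt hs hw hwK) (h.f_strict hs hz).hasDerivAt
    (h.f_deriv_ne hs hz) ?_).differentiableAt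
  rw [← e, eventually_map]
  filter_upwards [isOpen_UHP.mem_nhds hz] with z' hz'
  simp [h.gf s hs z' hz']

lemma LC.g_inj (h : LC T γ f g lam) {s : ℝ} (hs : s ∈ Icc 0 T)
    {w w' : ℂ} (hw : w ∈ UHP) (hwK : w ∉ γ '' Ioc 0 s) (hw' : w' ∈ UHP)
    (hwK' : w' ∉ γ '' Ioc 0 s) (he : g s w = g s w') : w = w' := by
  rw [← h.fg s hs w hw hwK, he, h.fg s hs w' hw' hwK']

end

section
variable {T : ℝ} {γ : ℝ → ℂ} {f g : ℝ → ℂ → ℂ} {lam : ℝ → ℝ}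

lemma FlowOn.norm_deriv_le {z : ℝ → ℂ} {lam : ℝ → ℝ} {u c : ℝ} (hc : 0 < c)
    (hb : c ≤ ‖z u - (lam u : ℂ)‖) : ‖2 / (z u - (lam u : ℂ))‖ ≤ 2 / c := by
  rw [norm_div]
  simp only [Complex.norm_ofNat]
  gcongr

lemma norm_sub_eq_sq (z : ℂ) (l : ℝ) : ‖z - (l : ℂ)‖ ^ 2 = (z.re - l) ^ 2 + z.im ^ 2 := by
  rw [Complex.sq_norm, Complex.normSq_apply]; simp; ring

/-- Lower bound for the imaginary part when the driving point stays away. -/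
lemma FlowOn.im_lower {z : ℝ → ℂ} {lam : ℝ → ℝ} {a b c : ℝ} (hab : a ≤ b) (hc : 0 < c)
    (h : FlowOn z lam (Icc a b)) (hb : ∀ u ∈ Icc a b, c ≤ ‖z u - (lam u : ℂ)‖) :
    (z a).im * Real.exp (2 / c ^ 2 * a) ≤ (z b).im * Real.exp (2 / c ^ 2 * b) := by
  have key : AntitoneOn (fun u => -((z u).im * Real.exp (2 / c ^ 2 * u))) (Icc a b) := by
    apply antitoneOn_of_hasDerivAt (fun u hu => ((h.hasDerivAt_im hu).mul
      (((hasDerivAt_id u).const_mul (2 / c ^ 2)).exp)).neg)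
    intro u hu
    have h0 := (h u hu).1
    have h1 : c ^ 2 ≤ ((z u).re - lam u) ^ 2 + (z u).im ^ 2 := by
      rw [← norm_sub_eq_sq]; gcongr; exact hb u hu
    have h2 : 2 * (z u).im / (((z u).re - lam u) ^ 2 + (z u).im ^ 2) ≤ 2 * (z u).im / c ^ 2 := by
      gcongr
    simp only [id, mul_one, Left.neg_nonpos_iff]
    have he := Real.exp_pos (2 / c ^ 2 * u)
    have : -(2 * (z u).im / (((z u).re - lam u) ^ 2 + (z u).im ^ 2)) * Real.exp (2 / c ^ 2 * u) +
      (z u).im * (Real.exp (2 / c ^ 2 * u) * (2 / c ^ 2)) = Real.exp (2 / c ^ 2 * u) *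
      (2 * (z u).im / c ^ 2 - 2 * (z u).im / (((z u).re - lam u) ^ 2 + (z u).im ^ 2)) := by ring
    rw [this]
    exact mul_nonneg he.le (by linarith)
  have := key (left_mem_Icc.2 hab) (right_mem_Icc.2 hab) hab
  simp only at this
  linarith

/-- Two trajectories that stay away from the driving point cannot merge. -/
lemma FlowOn.no_merge {z z' : ℝ → ℂ} {lam : ℝ → ℝ} {a b c : ℝ} (hab : a ≤ b) (hc : 0 < c)
    (h : FlowOn z lam (Icc a b)) (h' : FlowOn z' lam (Icc a b))
    (hb : ∀ u ∈ Icc a b, c ≤ ‖z u - (lam u : ℂ)‖)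
    (hb' : ∀ u ∈ Icc a b, c ≤ ‖z' u - (lam u : ℂ)‖) :
    ‖z a - z' a‖ ^ 2 * Real.exp (4 / c ^ 2 * a) ≤ ‖z b - z' b‖ ^ 2 * Real.exp (4 / c ^ 2 * b) := by
  have key : AntitoneOn (fun u => -(‖z u - z' u‖ ^ 2 * Real.exp (4 / c ^ 2 * u))) (Icc a b) := by
    apply antitoneOn_of_hasDerivAt (fun u hu => (((h u hu).2.fun_sub (h' u hu).2).norm_sq.mul
      (((hasDerivAt_id u).const_mul (4 / c ^ 2)).exp)).neg)
    intro u hu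
    have n1 := hb u hu
    have n2 := hb' u hu
    have z1 : z u - (lam u : ℂ) ≠ 0 := norm_pos_iff.1 (by linarith)
    have z2 : z' u - (lam u : ℂ) ≠ 0 := norm_pos_iff.1 (by linarith)
    have e1 : 2 / (z u - (lam u : ℂ)) - 2 / (z' u - (lam u : ℂ)) =
      - 2 * (z u - z' u) / ((z u - (lam u : ℂ)) * (z' u - (lam u : ℂ))) := by
      field_simp; ring
    have e2 : ‖2 / (z u - (lam u : ℂ)) - 2 / (z' u - (lam u : ℂ))‖ ≤ 2 * ‖z u - z' u‖ / c ^ 2 := by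
      rw [e1, norm_div, norm_mul, norm_mul, norm_neg, Complex.norm_ofNat, sq]
      gcongr
    have e3 := abs_le.1 (abs_real_inner_le_norm (z u - z' u)
      (2 / (z u - (lam u : ℂ)) - 2 / (z' u - (lam u : ℂ))))
    have e4 : ‖z u - z' u‖ * ‖2 / (z u - (lam u : ℂ)) - 2 / (z' u - (lam u : ℂ))‖ ≤
      ‖z u - z' u‖ * (2 * ‖z u - z' u‖ / c ^ 2) := by gcongr
    have e5 : ‖z u - z' u‖ * (2 * ‖z u - z' u‖ / c ^ 2) = ‖z u - z' u‖ ^ 2 * (2 / c ^ 2) := by ring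
    have he := Real.exp_pos (4 / c ^ 2 * u)
    simp only [id, mul_one, Left.neg_nonpos_iff]
    generalize inner ℝ (z u - z' u) (2 / (z u - (lam u : ℂ)) - 2 / (z' u - (lam u : ℂ))) = I at *
    have : 2 * I * Real.exp (4 / c ^ 2 * u) + ‖z u - z' u‖ ^ 2 * (Real.exp (4 / c ^ 2 * u) *
      (4 / c ^ 2)) = Real.exp (4 / c ^ 2 * u) * (2 * (I + ‖z u - z' u‖ ^ 2 * (2 / c ^ 2))) := by ring
    rw [this]
    exact mul_nonneg he.le (by linarith)
  have := key (left_mem_Icc.2 hab) (right_mem_Icc.2 hab) hab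
  simp only at this
  linarith

/-- Claim A: the trajectory of `γ τ` comes close to the driving point before time `τ`. -/
lemma LC.tip_collides (h : LC T γ f g lam) {τ a c : ℝ} (hτ : τ ∈ Ioc 0 T) (ha : a ∈ Ico 0 τ)
    (hc : 0 < c) (hb : ∀ u ∈ Ico a τ, c ≤ ‖g u (γ τ) - (lam u : ℂ)‖) : False := by
  have hF := (h.tip_flow hτ)
  have hF' : FlowOn (fun u => g u (γ τ)) lam (Ico a τ) := hF.mono (Ico_subset_Ico_left ha.1)
  have hL : LipschitzOnWith (Real.toNNReal (2 / c)) (fun u => g u (γ τ)) (Ico a τ) := by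
    apply Convex.lipschitzOnWith_of_nnnorm_hasDerivWithin_le (convex_Ico a τ)
      (fun u hu => (hF' u hu).2.hasDerivWithinAt)
    intro u hu
    rw [← NNReal.coe_le_coe, coe_nnnorm, Real.coe_toNNReal _ (by positivity)]
    exact FlowOn.norm_deriv_le (z := fun u => g u (γ τ)) hc (hb u hu)
  obtain ⟨P, hP, hPe⟩ := hL.extend_finite_dimension
  have hPc := hP.continuous
  have haτ : a < τ := ha.2
  have hτT : τ ∈ Icc 0 T := ⟨hτ.1.le, hτ.2⟩
  have hclos : τ ∈ closure (Ico a τ) := by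
    rw [closure_Ico haτ.ne]; exact right_mem_Icc.2 haτ.le
  haveI : (nhdsWithin τ (Ico a τ)).NeBot := mem_closure_iff_nhdsWithin_neBot.1 hclos
  have hpt : Tendsto (fun u => g u (γ τ)) (nhdsWithin τ (Ico a τ)) (nhds (P τ)) := by
    refine (hPc.continuousAt.mono_left nhdsWithin_le_nhds).congr' ?_
    filter_upwards [self_mem_nhdsWithin] with u hu
    exact (hPe hu).symm
  have hlt : Tendsto lam (nhdsWithin τ (Ico a τ)) (nhds (lam τ)) :=
    (h.lc τ hτT).mono_left (nhdsWithin_mono _ (fun u hu => ⟨ha.1.trans hu.1, hu.2.le.trans hτ.2⟩))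
  have hlt' : Tendsto (fun u => (lam u : ℂ)) (nhdsWithin τ (Ico a τ)) (nhds (lam τ : ℂ)) :=
    (Complex.continuous_ofReal.tendsto _).comp hlt
  -- the limit is in the upper half-plane
  have hPU : P τ ∈ UHP := by
    have h1 : ∀ᶠ u in nhdsWithin τ (Ico a τ), (g a (γ τ)).im * Real.exp (2 / c ^ 2 * a) ≤
        (g u (γ τ)).im * Real.exp (2 / c ^ 2 * u) := by
      filter_upwards [self_mem_nhdsWithin] with u hu
      have hsub : Icc a u ⊆ Ico a τ := fun v hv => ⟨hv.1, hv.2.trans_lt hu.2⟩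
      exact (hF'.mono hsub).im_lower hu.1 hc (fun v hv => hb v (hsub hv))
    have h2 : Tendsto (fun u => (g u (γ τ)).im * Real.exp (2 / c ^ 2 * u))
        (nhdsWithin τ (Ico a τ)) (nhds ((P τ).im * Real.exp (2 / c ^ 2 * τ))) := by
      apply Tendsto.mul ((Complex.continuous_im.tendsto _).comp hpt)
      have : Continuous fun u : ℝ => Real.exp (2 / c ^ 2 * u) := by fun_prop
      exact this.continuousAt.mono_left nhdsWithin_le_nhds
    have h3 := ge_of_tendsto h2 h1
    have h4 : 0 < (g a (γ τ)).im := (hF' a ⟨le_rfl, haτ⟩).1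
    have h5 : 0 < (P τ).im * Real.exp (2 / c ^ 2 * τ) := lt_of_lt_of_le (by positivity) h3
    exact (pos_iff_pos_of_mul_pos h5).2 (Real.exp_pos _)
  have hPl : c ≤ ‖P τ - lam τ‖ := by
    apply ge_of_tendsto ((hpt.sub hlt').norm)
    filter_upwards [self_mem_nhdsWithin] with u hu using hb u hu
  -- compare with the trajectory ending at `P τ`
  set w := f τ (P τ) with hw
  have hwU := h.fU τ hτT _ hPU
  have hwK := h.fK τ hτT _ hPU
  have hQ := h.flow hwU hτ.2 hwK
  have hQτ : g τ w = P τ := h.gf τ hτT _ hPU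
  have hqt : Tendsto (fun u => g u w) (nhdsWithin τ (Ico a τ)) (nhds (P τ)) := by
    rw [← hQτ]
    exact (hQ τ ⟨hτ.1.le, le_rfl⟩).2.continuousAt.mono_left nhdsWithin_le_nhds
  have hqe : ∀ᶠ u in nhdsWithin τ (Ico a τ), c / 2 < ‖g u w - lam u‖ :=
    ((hqt.sub hlt').norm).eventually (lt_mem_nhds (by linarith))
  obtain ⟨e, he, hball⟩ := Metric.mem_nhdsWithin_iff.1 hqe
  set b := max a (τ - e / 2) with hbdef
  have hb1 : a ≤ b := le_max_left _ _
  have hb2 : b < τ := max_lt haτ (by linarith)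
  have hb3 : ∀ u ∈ Ico b τ, u ∈ Ico a τ ∧ c / 2 ≤ ‖g u w - lam u‖ := by
    intro u hu
    have hu1 : u ∈ Ico a τ := ⟨hb1.trans hu.1, hu.2⟩
    refine ⟨hu1, le_of_lt (hball ⟨?_, hu1⟩)⟩
    have : τ - e / 2 ≤ u := (le_max_right _ _).trans hu.1
    rw [Metric.mem_ball, Real.dist_eq, abs_lt]
    constructor <;> linarith [hu.2]
  have hzero : ‖g b (γ τ) - g b w‖ ^ 2 * Real.exp (4 / (c / 2) ^ 2 * b) ≤ 0 := by
    have h2 : Tendsto (fun u => ‖g u (γ τ) - g u w‖ ^ 2 * Real.exp (4 / (c / 2) ^ 2 * u))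
        (nhdsWithin τ (Ico a τ)) (nhds (‖P τ - P τ‖ ^ 2 * Real.exp (4 / (c / 2) ^ 2 * τ))) := by
      apply Tendsto.mul (((hpt.sub hqt).norm).pow 2)
      have : Continuous fun u : ℝ => Real.exp (4 / (c / 2) ^ 2 * u) := by fun_prop
      exact this.continuousAt.mono_left nhdsWithin_le_nhds
    simp only [sub_self, norm_zero, ne_eq, OfNat.ofNat_ne_zero, not_false_eq_true, zero_pow,
      zero_mul] at h2
    apply ge_of_tendsto h2
    have hge : ∀ᶠ u in nhdsWithin τ (Ico a τ), b < u :=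
      (eventually_gt_nhds hb2).filter_mono nhdsWithin_le_nhds
    filter_upwards [self_mem_nhdsWithin, hge] with u hu hbu
    have hsub : Icc b u ⊆ Ico b τ := fun v hv => ⟨hv.1, hv.2.trans_lt hu.2⟩
    apply FlowOn.no_merge (z := fun u => g u (γ τ)) (z' := fun u => g u w) (lam := lam) hbu.le
      (by linarith) (hF'.mono fun v hv => (hb3 v (hsub hv)).1)
      (hQ.mono fun v hv => ⟨ha.1.trans (hb1.trans hv.1), (hsub hv).2.le⟩)
    · exact fun v hv => by linarith [hb v (hb3 v (hsub hv)).1]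
    · exact fun v hv => (hb3 v (hsub hv)).2
  have hzero2 : g b (γ τ) = g b w := by
    have := nonpos_of_mul_nonpos_left hzero (Real.exp_pos _)
    have h0 : ‖g b (γ τ) - g b w‖ = 0 := by
      have := sq_nonneg ‖g b (γ τ) - g b w‖
      exact pow_eq_zero_iff (two_ne_zero) |>.1 (by linarith)
    exact sub_eq_zero.1 (norm_eq_zero.1 h0)
  have hbT : b ∈ Icc 0 T := ⟨ha.1.trans hb1, hb2.le.trans hτ.2⟩
  have := h.g_inj hbT (h.γU τ hτ) (h.tip_notMem hb2 hτ) hwU (LC.notMem_mono hb2.le hwK) hzero2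
  exact hwK (this ▸ ⟨τ, ⟨hτ.1, le_rfl⟩, rfl⟩)

/-- Claim B: the curve seen at time `u₀` starts at the driving point. -/
lemma LC.tip_tendsto (h : LC T γ f g lam) {u₀ ε : ℝ} (hu : u₀ ∈ Ico 0 T) (hε : 0 < ε) :
    ∃ e > 0, ∀ u' ∈ Ioo u₀ (u₀ + e), u' ≤ T → ‖g u₀ (γ u') - (lam u₀ : ℂ)‖ < ε := by
  obtain ⟨e1, he1, hl⟩ := Metric.continuousWithinAt_iff.1 (h.lc u₀ ⟨hu.1, hu.2.le⟩) (ε / 4)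
    (by linarith)
  refine ⟨min e1 (ε ^ 2 / 64), by positivity, fun u' hu' hu'T => ?_⟩
  by_contra hcon
  push Not at hcon
  have h1 : u' - u₀ < e1 := by have := min_le_left e1 (ε ^ 2 / 64); linarith [hu'.2]
  have h2 : u' - u₀ < ε ^ 2 / 64 := by have := min_le_right e1 (ε ^ 2 / 64); linarith [hu'.2]
  have hτ : u' ∈ Ioc 0 T := ⟨by linarith [hu.1, hu'.1], hu'T⟩
  have hlam : ∀ v ∈ Ico u₀ u', ‖(lam v : ℂ) - lam u₀‖ < ε / 4 := by
    intro v hv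
    have := hl (x := v) ⟨by linarith [hu.1, hv.1], by linarith [hv.2]⟩
      (by rw [Real.dist_eq, abs_lt]; constructor <;> linarith [hv.1, hv.2])
    rw [Real.dist_eq] at this
    rw [← Complex.ofReal_sub, Complex.norm_real, Real.norm_eq_abs]
    exact this
  have hF := h.tip_flow hτ
  -- as long as the point has moved by at most `ε / 2`, it is away from the driving point
  have haway : ∀ v ∈ Ico u₀ u', ‖g v (γ u') - g u₀ (γ u')‖ ≤ ε / 2 →
      ε / 4 ≤ ‖g v (γ u') - (lam v : ℂ)‖ := by
    intro v hv hm
    have a1 := hlam v hv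
    have a2 : ‖g u₀ (γ u') - (lam u₀ : ℂ)‖ ≤ ‖g v (γ u') - g u₀ (γ u')‖ +
        ‖g v (γ u') - (lam v : ℂ)‖ + ‖(lam v : ℂ) - lam u₀‖ := by
      have : g u₀ (γ u') - (lam u₀ : ℂ) = -(g v (γ u') - g u₀ (γ u')) +
        (g v (γ u') - (lam v : ℂ)) + ((lam v : ℂ) - lam u₀) := by ring
      rw [this]
      refine (norm_add_le _ _).trans ?_
      gcongr
      refine (norm_add_le _ _).trans ?_
      rw [norm_neg]
    linarith
  have hsmall : ∀ v ∈ Icc u₀ u', 9 / ε * (v - u₀) ≤ ε / 2 := by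
    intro v hv
    have : 9 / ε * (v - u₀) ≤ 9 / ε * (ε ^ 2 / 64) := by gcongr; linarith [hv.2]
    have e : 9 / ε * (ε ^ 2 / 64) = 9 / 64 * ε := by field_simp
    linarith
  have hmove : ∀ v ∈ Ico u₀ u', ‖g v (γ u') - g u₀ (γ u')‖ ≤ ε / 2 := by
    intro v hv
    have hsub : Icc u₀ v ⊆ Ico 0 u' := fun x hx => ⟨hu.1.trans hx.1, hx.2.trans_lt hv.2⟩
    have hFv := hF.mono hsub
    refine le_trans (image_norm_le_of_norm_deriv_right_lt_deriv_boundary'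
      (f := fun v => g v (γ u') - g u₀ (γ u'))
      (f' := fun v => 2 / (g v (γ u') - (lam v : ℂ))) (B := fun v => 9 / ε * (v - u₀))
      (B' := fun _ => 9 / ε) (hFv.contOn.sub continuousOn_const)
      (fun x hx => ((hFv x ⟨hx.1, hx.2.le⟩).2.sub_const _).hasDerivWithinAt) (by simp)
      (by fun_prop) (fun x hx => ?_) (fun x hx hxe => ?_) (right_mem_Icc.2 hv.1))
      (hsmall v ⟨hv.1, hv.2.le⟩)
    · have := ((hasDerivAt_id x).sub_const u₀).const_mul (9 / ε)
      simpa using this.hasDerivWithinAt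
    · have hx' : x ∈ Ico u₀ u' := ⟨hx.1, hx.2.trans hv.2⟩
      have hm := hsmall x ⟨hx'.1, hx'.2.le⟩
      have := FlowOn.norm_deriv_le (z := fun v => g v (γ u')) (lam := lam) (u := x)
        (c := ε / 4) (by linarith) (haway x hx' (by rw [hxe]; exact hm))
      refine this.trans_lt ?_
      have e : 2 / (ε / 4) = 8 / ε := by field_simp; norm_num
      rw [e]
      gcongr
      norm_num
  exact h.tip_collides hτ (a := u₀) (c := ε / 4) ⟨hu.1, hu'.1⟩ (by linarith)
    (fun v hv => haway v hv (hmove v hv))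
end

/-- An open rectangle based on the real line. -/
def HR (a b m : ℝ) : Set ℂ := {w : ℂ | (a < w.re ∧ w.re < b) ∧ 0 < w.im ∧ w.im < m}

lemma isOpen_HR (a b m : ℝ) : IsOpen (HR a b m) := by
  apply IsOpen.inter
  · exact (isOpen_lt continuous_const Complex.continuous_re).inter
      (isOpen_lt Complex.continuous_re continuous_const)
  · exact (isOpen_lt continuous_const Complex.continuous_im).inter
      (isOpen_lt Complex.continuous_im continuous_const)

lemma convex_HR (a b m : ℝ) : Convex ℝ (HR a b m) := by
  exact ((convex_Ioo a b).linear_preimage Complex.reLm).inter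
    ((convex_Ioo (0:ℝ) m).linear_preimage Complex.imLm)

lemma deriv_bound {G : ℂ → ℂ} {w : ℂ} (hw : 0 < w.im)
    (hd : DifferentiableOn ℂ G (ball w w.im)) (hp : ∀ z ∈ ball w w.im, 0 < (G z).im)
    (hi : (G w).im ≤ w.im) : ‖deriv G w‖ ≤ 3 := by
  set y := w.im with hy
  set r := y * (19 / 20) with hr
  have hr0 : 0 < r := by positivity
  have hry : r < y := by rw [hr]; linarith
  have hsub : closedBall w r ⊆ ball w y := closedBall_subset_ball hry
  let E : ℂ → ℂ := fun z => Complex.exp (Complex.I * G z / y)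
  have hEn : ∀ z, ‖E z‖ = Real.exp (-(G z).im / y) := by
    intro z
    simp only [E, Complex.norm_exp]
    congr 1
    rw [Complex.div_ofReal_re]; simp
  have hEd : DifferentiableOn ℂ E (ball w y) := by
    apply DifferentiableOn.cexp
    exact (hd.const_mul _).div_const _
  have h1 : ‖deriv E w‖ ≤ 1 / r := by
    apply Complex.norm_deriv_le_of_forall_mem_sphere_norm_le hr0
    · apply DifferentiableOn.diffContOnCl
      rw [closure_ball w hr0.ne']
      exact hEd.mono hsub
    · intro z hz
      rw [hEn, Real.exp_le_one_iff]
      have := hp z (hsub (sphere_subset_closedBall hz))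
      rw [neg_div]
      have : 0 < (G z).im / y := by positivity
      linarith
  have hG : HasDerivAt G (deriv G w) w :=
    (hd.differentiableAt (ball_mem_nhds w hw)).hasDerivAt
  have h2 : HasDerivAt E (E w * (Complex.I * deriv G w / y)) w :=
    ((hG.const_mul Complex.I).div_const (y:ℂ)).cexp
  rw [h2.deriv, norm_mul, hEn, norm_div, norm_mul, Complex.norm_I, one_mul, Complex.norm_real,
    Real.norm_eq_abs, abs_of_pos hw] at h1
  have h3 : Real.exp (-1) ≤ Real.exp (-(G w).im / y) := by
    apply Real.exp_le_exp.2
    rw [neg_div, neg_le_neg_iff, div_le_one hw]; exact hi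
  have h4 : Real.exp (-1) * (‖deriv G w‖ / y) ≤ 1 / r :=
    le_trans (by gcongr) h1
  have h5 : Real.exp (-1) * ‖deriv G w‖ ≤ 20 / 19 := by
    have : Real.exp (-1) * ‖deriv G w‖ = Real.exp (-1) * (‖deriv G w‖ / y) * y := by
      field_simp
    rw [this]
    calc _ ≤ 1 / r * y := by gcongr
      _ = 20 / 19 := by rw [hr]; field_simp
  rw [Real.exp_neg, inv_mul_le_iff₀ (Real.exp_pos 1)] at h5
  have := Real.exp_one_lt_d9
  linarith

lemma ball_sub_HR {a b m m' : ℝ} (hm : 2 * m' ≤ m) {w : ℂ} (hw : w ∈ HR (a + m') (b - m') m') :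
    ball w w.im ⊆ HR a b m := by
  intro z hz
  rw [mem_ball, Complex.dist_eq] at hz
  have h1 := (Complex.abs_re_le_norm (z - w)).trans_lt hz
  have h2 := (Complex.abs_im_le_norm (z - w)).trans_lt hz
  rw [Complex.sub_re, abs_lt] at h1
  rw [Complex.sub_im, abs_lt] at h2
  obtain ⟨⟨ha, hb⟩, h0, h3⟩ := hw
  exact ⟨⟨by linarith, by linarith⟩, by linarith, by linarith⟩

/-- Boundary values. -/
lemma exists_bdry {G : ℂ → ℂ} {a b m m' : ℝ} (hm : 2 * m' ≤ m)
    (hd : DifferentiableOn ℂ G (HR a b m)) (hp : ∀ z ∈ HR a b m, 0 < (G z).im)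
    (hi : ∀ z ∈ HR a b m, (G z).im ≤ z.im) :
    ∃ X : ℝ → ℝ, ∀ w ∈ HR (a + m') (b - m') m', ‖G w - (X w.re : ℂ)‖ ≤ 4 * w.im := by
  have hL : LipschitzOnWith 3 G (HR (a + m') (b - m') m') := by
    apply Convex.lipschitzOnWith_of_nnnorm_deriv_le (𝕜 := ℂ) _ _ (convex_HR _ _ _)
    · intro w hw
      have hs := ball_sub_HR hm hw
      exact (hd.mono hs).differentiableAt (ball_mem_nhds w hw.2.1)
    · intro w hw
      have hs := ball_sub_HR hm hw
      have := deriv_bound hw.2.1 (hd.mono hs) (fun z hz => hp z (hs hz))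
        (hi w (hs (mem_ball_self hw.2.1)))
      rw [← NNReal.coe_le_coe]
      simpa using this
  have hL2 : LipschitzOnWith 3 (fun w => (G w).re) (HR (a + m') (b - m') m') := by
    apply LipschitzOnWith.of_dist_le_mul
    intro x hx y hy
    refine le_trans ?_ (hL.dist_le_mul x hx y hy)
    rw [Real.dist_eq, Complex.dist_eq, ← Complex.sub_re]
    exact Complex.abs_re_le_norm _
  obtain ⟨Y, hY, hYe⟩ := hL2.extend_real
  refine ⟨fun x => Y x, fun w hw => ?_⟩
  have e1 : ‖G w - (Y w.re : ℂ)‖ ≤ |(G w).re - Y w.re| + |(G w).im| := by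
    have := Complex.norm_le_abs_re_add_abs_im (G w - (Y w.re : ℂ))
    simpa using this
  have hwm := ball_sub_HR hm hw (mem_ball_self hw.2.1)
  have e2 : |(G w).im| ≤ w.im := by
    rw [abs_of_pos (hp w hwm)]; exact hi w hwm
  have e3 : |(G w).re - Y w.re| ≤ 3 * w.im := by
    have h1 : (G w).re = Y w := hYe hw
    have h2 := hY.dist_le_mul w (w.re : ℂ)
    have h3 : dist w (w.re : ℂ) = w.im := by
      rw [Complex.dist_eq]
      have : w - (w.re : ℂ) = (w.im : ℂ) * Complex.I := by
        apply Complex.ext <;> simp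
      rw [this]; simp [abs_of_pos hw.2.1]
    rw [h3, Real.dist_eq, ← h1] at h2
    simpa using h2
  linarith

/-- Product trick on the square. -/
lemma square_bound {F : ℂ → ℂ} {c : ℂ} {r M ε : ℝ} (hr : 0 < r) (hε : 0 ≤ ε)
    (hd : ∀ z : ℂ, |z.re| ≤ r → |z.im| ≤ r → DifferentiableAt ℂ F (c + z))
    (hM : ∀ z : ℂ, |z.re| ≤ r → |z.im| ≤ r → ‖F (c + z)‖ ≤ M)
    (he : ∀ z : ℂ, |z.re| ≤ r → z.im = -r → ‖F (c + z)‖ ≤ ε) :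
    ‖F c‖ ^ 4 ≤ ε * M ^ 3 := by
  let P : ℂ → ℂ := fun z => F (c + z) * F (c + Complex.I * z) * F (c + -z) * F (c + -Complex.I * z)
  let U : Set ℂ := {z : ℂ | |z.re| < r ∧ |z.im| < r}
  have hUeq : U = Ioo (-r) r ×ℂ Ioo (-r) r := by
    ext z; simp [U, abs_lt, Complex.mem_reProdIm]
  have hcl : closure U = Icc (-r) r ×ℂ Icc (-r) r := by
    rw [hUeq, Complex.closure_reProdIm, closure_Ioo (by linarith)]
  have hclm : ∀ z ∈ closure U, |z.re| ≤ r ∧ |z.im| ≤ r := by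
    intro z hz
    rw [hcl, Complex.mem_reProdIm] at hz
    exact ⟨abs_le.2 hz.1, abs_le.2 hz.2⟩
  have hUo : IsOpen U := by
    rw [hUeq]; exact isOpen_Ioo.reProdIm isOpen_Ioo
  have hM0 : 0 ≤ M := (norm_nonneg _).trans (hM 0 (by simp [hr.le]) (by simp [hr.le]))
  have hPd : DiffContOnCl ℂ P U := by
    apply DifferentiableOn.diffContOnCl
    intro z hz
    obtain ⟨h1, h2⟩ := hclm z hz
    apply DifferentiableAt.differentiableWithinAt
    have k1 : DifferentiableAt ℂ (fun z => F (c + z)) z :=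
      DifferentiableAt.comp (g := F) z (hd z h1 h2) (by fun_prop)
    have k2 : DifferentiableAt ℂ (fun z => F (c + Complex.I * z)) z :=
      DifferentiableAt.comp (g := F) z (hd _ (by simpa using h2) (by simpa using h1)) (by fun_prop)
    have k3 : DifferentiableAt ℂ (fun z => F (c + -z)) z :=
      DifferentiableAt.comp (g := F) z (hd _ (by simpa using h1) (by simpa using h2)) (by fun_prop)
    have k4 : DifferentiableAt ℂ (fun z => F (c + -Complex.I * z)) z :=
      DifferentiableAt.comp (g := F) z (hd _ (by simpa using h2) (by simpa using h1)) (by fun_prop)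
    exact ((k1.mul k2).mul k3).mul k4
  have hb : Bornology.IsBounded U := by
    rw [hUeq]
    exact (Metric.isBounded_Ioo _ _).reProdIm (Metric.isBounded_Ioo _ _)
  have hfr : ∀ z ∈ frontier U, ‖P z‖ ≤ ε * M ^ 3 := by
    intro z hz
    have hz1 := hclm z hz.1
    rw [hUo.frontier_eq] at hz
    have hz2 : ¬ (|z.re| < r ∧ |z.im| < r) := hz.2
    obtain ⟨h1, h2⟩ := hz1
    have b1 := hM z h1 h2
    have b2 := hM (Complex.I * z) (by simpa using h2) (by simpa using h1)
    have b3 := hM (-z) (by simpa using h1) (by simpa using h2)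
    have b4 := hM (-Complex.I * z) (by simpa using h2) (by simpa using h1)
    have hcase : |z.re| = r ∨ |z.im| = r := by
      by_contra hcon
      push Not at hcon
      exact hz2 ⟨lt_of_le_of_ne h1 hcon.1, lt_of_le_of_ne h2 hcon.2⟩
    simp only [P, norm_mul]
    have fin : ∀ x1 x2 x3 x4 : ℝ, 0 ≤ x1 → 0 ≤ x2 → 0 ≤ x3 → 0 ≤ x4 → x1 ≤ ε → x2 ≤ M → x3 ≤ M →
        x4 ≤ M → x1 * x2 * x3 * x4 ≤ ε * M ^ 3 := by
      intro x1 x2 x3 x4 _ _ _ _ _ _ _ _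
      calc x1 * x2 * x3 * x4 ≤ ε * M * M * M := by gcongr
        _ = ε * M ^ 3 := by ring
    rcases hcase with hc | hc <;> rcases abs_choice (z.re) with hh | hh <;>
      rcases abs_choice (z.im) with hh' | hh'
    all_goals
      first
      | (have q := he z h1 (by linarith)
         exact fin _ _ _ _ (norm_nonneg _) (norm_nonneg _) (norm_nonneg _) (norm_nonneg _) q b2 b3 b4)
      | (have q := he (Complex.I * z) (by simpa using h2) (by simp; linarith)
         have := fin _ _ _ _ (norm_nonneg _) (norm_nonneg _) (norm_nonneg _) (norm_nonneg _) q b1 b3 b4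
         linarith)
      | (have q := he (-z) (by simpa using h1) (by simp; linarith)
         have := fin _ _ _ _ (norm_nonneg _) (norm_nonneg _) (norm_nonneg _) (norm_nonneg _) q b2 b1 b4
         linarith)
      | (have q := he (-Complex.I * z) (by simpa using h2) (by simp; linarith)
         have := fin _ _ _ _ (norm_nonneg _) (norm_nonneg _) (norm_nonneg _) (norm_nonneg _) q b2 b3 b1
         linarith)
  have := Complex.norm_le_of_forall_mem_frontier_norm_le hb hPd hfr (z := 0)
    (subset_closure (by simp [U, hr]))
  simp only [P, norm_mul, add_zero, mul_zero, neg_zero] at this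
  calc _ = ‖F c‖ * ‖F c‖ * ‖F c‖ * ‖F c‖ := by ring
    _ ≤ _ := this

/-- Boundary values are not constant on intervals. -/
lemma bdry_not_const {G : ℂ → ℂ} {X : ℝ → ℝ} {a b m l : ℝ}
    (hd : DifferentiableOn ℂ G (HR a b m)) (hp : ∀ z ∈ HR a b m, 0 < (G z).im)
    (hX : ∀ w ∈ HR a b m, ‖G w - (X w.re : ℂ)‖ ≤ 4 * w.im) {x1 x2 : ℝ} (h1 : a < x1) (h12 : x1 < x2)
    (h2 : x2 < b) (hm : 0 < m) : ∃ x ∈ Ioo x1 x2, X x ≠ l := by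
  by_contra hcon
  push Not at hcon
  set r := min ((x2 - x1) / 3) (m / 3) with hr
  have hr1 : r ≤ (x2 - x1) / 3 := min_le_left _ _
  have hr2 : r ≤ m / 3 := min_le_right _ _
  have hr0 : 0 < r := by
    apply lt_min <;> linarith
  set x := (x1 + x2) / 2 with hx
  -- the bound at the height `r + η`
  have key : ∀ η ∈ Ioo 0 r, ‖G ⟨x, r + η⟩ - (l : ℂ)‖ ^ 4 ≤ (4 * η) * (4 * m) ^ 3 := by
    intro η hη
    have hmem : ∀ z : ℂ, |z.re| ≤ r → |z.im| ≤ r → (⟨x, r + η⟩ + z : ℂ) ∈ HR a b m ∧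
        ((⟨x, r + η⟩ + z : ℂ)).re ∈ Ioo x1 x2 := by
      intro z h1 h2
      rw [abs_le] at h1 h2
      obtain ⟨h1a, h1b⟩ := h1
      obtain ⟨h2a, h2b⟩ := h2
      obtain ⟨h3, h4⟩ := hη
      refine ⟨⟨⟨?_, ?_⟩, ?_, ?_⟩, ?_, ?_⟩ <;>
        simp only [Complex.add_re, Complex.add_im] <;> linarith
    refine square_bound (F := fun z => G z - (l : ℂ)) hr0 (by linarith [hη.1]) ?_ ?_ ?_
    · intro z h1 h2
      exact ((hd.differentiableAt ((isOpen_HR a b m).mem_nhds (hmem z h1 h2).1))).sub_const _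
    · intro z h1 h2
      have q := hX _ (hmem z h1 h2).1
      rw [hcon _ (hmem z h1 h2).2] at q
      have := (hmem z h1 h2).1.2.2
      linarith
    · intro z h1 h2
      have h2' : |z.im| ≤ r := by rw [h2, abs_neg, abs_of_pos hr0]
      have q := hX _ (hmem z h1 h2').1
      rw [hcon _ (hmem z h1 h2').2] at q
      refine q.trans ?_
      simp [h2]
  have hc : (⟨x, r⟩ : ℂ) ∈ HR a b m := by
    refine ⟨⟨?_, ?_⟩, ?_, ?_⟩ <;> dsimp only <;> linarith
  have hcont : ContinuousAt G ⟨x, r⟩ := by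
    exact (hd.differentiableAt ((isOpen_HR a b m).mem_nhds hc)).continuousAt
  have ht : Tendsto (fun η : ℝ => (⟨x, r + η⟩ : ℂ)) (nhdsWithin 0 (Ioi 0)) (nhds ⟨x, r⟩) := by
    have : Continuous (fun η : ℝ => (⟨x, r + η⟩ : ℂ)) := by
      have : (fun η : ℝ => (⟨x, r + η⟩ : ℂ)) = fun η : ℝ => (x : ℂ) + ((r + η : ℝ) : ℂ) * Complex.I := by
        ext η; apply Complex.ext <;> simp
      rw [this]; fun_prop
    have := this.tendsto 0
    simp only [add_zero] at this
    exact this.mono_left nhdsWithin_le_nhds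
  have lim1 : Tendsto (fun η : ℝ => ‖G ⟨x, r + η⟩ - (l : ℂ)‖ ^ 4) (nhdsWithin 0 (Ioi 0))
      (nhds (‖G ⟨x, r⟩ - (l : ℂ)‖ ^ 4)) :=
    (((hcont.tendsto.comp ht).sub_const _).norm.pow 4)
  have lim2 : Tendsto (fun η : ℝ => (4 * η) * (4 * m) ^ 3) (nhdsWithin 0 (Ioi 0))
      (nhds 0) := by
    have : Continuous (fun η : ℝ => (4 * η) * (4 * m) ^ 3) := by fun_prop
    have := this.tendsto 0
    simp only [mul_zero, zero_mul] at this
    exact this.mono_left nhdsWithin_le_nhds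
  have hle := le_of_tendsto_of_tendsto lim1 lim2
    (by filter_upwards [Ioo_mem_nhdsGT hr0] with η hη using key η hη)
  have hz : ‖G ⟨x, r⟩ - (l : ℂ)‖ = 0 := by
    have := norm_nonneg (G ⟨x, r⟩ - (l : ℂ))
    by_contra hne
    have : 0 < ‖G ⟨x, r⟩ - (l : ℂ)‖ ^ 4 := by positivity
    linarith
  rw [norm_eq_zero, sub_eq_zero] at hz
  have := hp _ hc
  rw [hz] at this
  simp at this

/-- Open mapping at the boundary. -/
lemma bdry_open {G : ℂ → ℂ} {X : ℝ → ℝ} {a b m x : ℝ} (hm : 0 < m)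
    (hd : DifferentiableOn ℂ G (HR a b m)) (hp : ∀ z ∈ HR a b m, 0 < (G z).im)
    (hi : ∀ z ∈ HR a b m, (G z).im ≤ z.im)
    (hX : ∀ w ∈ HR a b m, ‖G w - (X w.re : ℂ)‖ ≤ 4 * w.im) (ha : a < x) (hb : x < b) :
    ∃ c > 0, ∀ ζ : ℂ, 0 < ζ.im → ‖ζ - (X x : ℂ)‖ < c → ∃ w ∈ HR a b m, G w = ζ := by
  obtain ⟨x1, hx1, hl1⟩ := bdry_not_const hd hp hX (l := X x) (x1 := (a + x) / 2) (x2 := x)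
    (by linarith) (by linarith) (by linarith) hm
  obtain ⟨x2, hx2, hl2⟩ := bdry_not_const hd hp hX (l := X x) (x1 := x) (x2 := (x + b) / 2)
    (by linarith) (by linarith) (by linarith) hm
  have hx1a : a < x1 := by linarith [hx1.1]
  have hx2b : x2 < b := by linarith [hx2.2]
  set d1 := |X x1 - X x| with hd1
  set d2 := |X x2 - X x| with hd2
  have hd10 : 0 < d1 := abs_pos.2 (sub_ne_zero.2 hl1)
  have hd20 : 0 < d2 := abs_pos.2 (sub_ne_zero.2 hl2)
  set H := m / 2 with hH
  set y0 := min H (min (d1 / 8) (d2 / 8)) with hy0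
  have hy00 : 0 < y0 := by
    refine lt_min (by linarith) (lt_min (by linarith) (by linarith))
  have hy0H : y0 ≤ H := min_le_left _ _
  have hy01 : y0 ≤ d1 / 8 := (min_le_right _ _).trans (min_le_left _ _)
  have hy02 : y0 ≤ d2 / 8 := (min_le_right _ _).trans (min_le_right _ _)
  have hcG : ContinuousOn G (HR a b m) := hd.continuousOn
  obtain ⟨c, hc0, hc⟩ : ∃ c > 0, ∀ z : ℂ, z.re ∈ Icc x1 x2 → z.im ∈ Icc y0 H → c ≤ (G z).im := by
    have hcomp : IsCompact (Icc x1 x2 ×ℂ Icc y0 H) := isCompact_Icc.reProdIm isCompact_Icc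
    have hsub : (Icc x1 x2 ×ℂ Icc y0 H) ⊆ HR a b m := by
      intro z hz
      rw [Complex.mem_reProdIm] at hz
      exact ⟨⟨by linarith [hz.1.1], by linarith [hz.1.2]⟩, by linarith [hz.2.1], by linarith [hz.2.2]⟩
    obtain ⟨z0, hz0, hmin⟩ := hcomp.exists_isMinOn
      ⟨(⟨x1, y0⟩ : ℂ), by
        rw [Complex.mem_reProdIm]
        exact ⟨⟨le_rfl, by linarith [hx1.2, hx2.1]⟩, ⟨le_rfl, hy0H⟩⟩⟩
      (Complex.continuous_im.comp_continuousOn (hcG.mono hsub))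
    exact ⟨(G z0).im, hp z0 (hsub hz0), fun z h1 h2 => hmin (Complex.mem_reProdIm.2 ⟨h1, h2⟩)⟩
  set c0 := min c (min (d1 / 2) (d2 / 2)) with hc0def
  have hc00 : 0 < c0 := lt_min hc0 (lt_min (by linarith) (by linarith))
  have hc0c : c0 ≤ c := min_le_left _ _
  have hc01 : c0 ≤ d1 / 2 := (min_le_right _ _).trans (min_le_left _ _)
  have hc02 : c0 ≤ d2 / 2 := (min_le_right _ _).trans (min_le_right _ _)
  have him : ∀ w : ℂ, (w.im ≤ ‖w - (X x : ℂ)‖) := by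
    intro w
    have := (le_abs_self _).trans (Complex.abs_im_le_norm (w - (X x : ℂ)))
    simpa using this
  -- on the arc, `G` is far from `X x`
  have harc : ∀ z : ℂ, z.re ∈ Icc x1 x2 → 0 < z.im → z.im ≤ H →
      (z.re = x1 ∨ z.re = x2 ∨ z.im = H) → c0 ≤ ‖G z - (X x : ℂ)‖ := by
    intro z hz1 hz2 hz3 hz4
    by_cases hy : y0 ≤ z.im
    · exact (hc0c.trans (hc z hz1 ⟨hy, hz3⟩)).trans (him _)
    push Not at hy
    have hzm : z ∈ HR a b m := ⟨⟨by linarith [hz1.1], by linarith [hz1.2]⟩, hz2, by linarith⟩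
    have q := hX z hzm
    have tri : |X z.re - X x| ≤ ‖G z - (X z.re : ℂ)‖ + ‖G z - (X x : ℂ)‖ := by
      have : ‖((X z.re : ℂ)) - (X x : ℂ)‖ = |X z.re - X x| := by
        rw [← Complex.ofReal_sub, Complex.norm_real, Real.norm_eq_abs]
      rw [← this]
      calc _ = ‖(G z - (X x : ℂ)) - (G z - (X z.re : ℂ))‖ := by congr 1; ring
        _ ≤ _ := by rw [add_comm]; exact norm_sub_le _ _
    rcases hz4 with h | h | h
    · rw [h, ← hd1] at tri
      rw [h] at q
      linarith
    · rw [h, ← hd2] at tri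
      rw [h] at q
      linarith
    · linarith
  have hVsub : HR x1 x2 H ⊆ HR a b m := by
    intro z hz
    exact ⟨⟨by linarith [hz.1.1], by linarith [hz.1.2]⟩, hz.2.1, by linarith [hz.2.2]⟩
  have hVo : IsOpen (G '' HR x1 x2 H) := by
    rcases (hd.analyticOnNhd (isOpen_HR a b m)).is_constant_or_isOpen
      (convex_HR a b m).isPreconnected with ⟨w, hw⟩ | h
    · exfalso
      have hk : ∀ y ∈ Ioo 0 m, (⟨x, y⟩ : ℂ) ∈ HR a b m := fun y hy => ⟨⟨ha, hb⟩, hy.1, hy.2⟩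
      have h1 := hp _ (hk (m / 2) ⟨by linarith, by linarith⟩)
      have h1' := hi _ (hk (m / 2) ⟨by linarith, by linarith⟩)
      rw [hw _ (hk (m / 2) ⟨by linarith, by linarith⟩)] at h1 h1'
      dsimp only at h1'
      have h2 := hi _ (hk (w.im / 2) ⟨by linarith, by linarith⟩)
      rw [hw _ (hk (w.im / 2) ⟨by linarith, by linarith⟩)] at h2
      dsimp only at h2
      linarith
    · exact h _ hVsub (isOpen_HR _ _ _)
  let Δ : Set ℂ := {ζ : ℂ | 0 < ζ.im} ∩ ball (X x : ℂ) c0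
  have hΔ : IsPreconnected Δ := by
    apply Convex.isPreconnected
    exact (convex_halfSpace_im_gt 0).inter (convex_ball _ _)
  have hsubset : Δ ⊆ G '' HR x1 x2 H := by
    apply hΔ.subset_of_closure_inter_subset hVo
    · set η := min (H / 2) (c0 / 8) with hη
      have hη0 : 0 < η := lt_min (by linarith) (by linarith)
      have hη1 : η ≤ H / 2 := min_le_left _ _
      have hη2 : η ≤ c0 / 8 := min_le_right _ _
      have hmem : (⟨x, η⟩ : ℂ) ∈ HR x1 x2 H := ⟨⟨hx1.2, hx2.1⟩, hη0, by dsimp only; linarith⟩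
      refine ⟨G ⟨x, η⟩, ⟨hp _ (hVsub hmem), ?_⟩, mem_image_of_mem _ hmem⟩
      rw [mem_ball, Complex.dist_eq]
      have := hX _ (hVsub hmem)
      dsimp only at this
      linarith
    · rintro ζ ⟨hζ, hζΔ⟩
      obtain ⟨v, hv, hvt⟩ := mem_closure_iff_seq_limit.1 hζ
      choose z hz hzv using hv
      have hcomp : IsCompact (Icc x1 x2 ×ℂ Icc 0 H) := isCompact_Icc.reProdIm isCompact_Icc
      obtain ⟨p, hp1, φ, hφ, hlim⟩ := hcomp.tendsto_subseq (x := z) (fun n => by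
        rw [Complex.mem_reProdIm]
        have := hz n
        exact ⟨⟨this.1.1.le, this.1.2.le⟩, ⟨this.2.1.le, this.2.2.le⟩⟩)
      rw [Complex.mem_reProdIm] at hp1
      have hvφ : Tendsto (fun n => G (z (φ n))) atTop (nhds ζ) := by
        simp only [hzv]
        exact hvt.comp hφ.tendsto_atTop
      have hζim : 0 < ζ.im := hζΔ.1
      have hle : ζ.im ≤ p.im := by
        have l1 := (Complex.continuous_im.tendsto ζ).comp hvφ
        have l2 := (Complex.continuous_im.tendsto p).comp hlim
        exact le_of_tendsto_of_tendsto' l1 l2 (fun n => hi _ (hVsub (hz _)))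
      have hp0 : 0 < p.im := by linarith
      have hpm : p ∈ HR a b m := ⟨⟨by linarith [hp1.1.1], by linarith [hp1.1.2]⟩, hp0,
        by linarith [hp1.2.2]⟩
      have hGp : G p = ζ := by
        have : ContinuousAt G p := hcG.continuousAt ((isOpen_HR a b m).mem_nhds hpm)
        exact tendsto_nhds_unique (this.tendsto.comp hlim) hvφ
      refine ⟨p, ?_, hGp⟩
      by_contra hnp
      have hcase : p.re = x1 ∨ p.re = x2 ∨ p.im = H := by
        by_contra hcon
        push Not at hcon
        exact hnp ⟨⟨lt_of_le_of_ne hp1.1.1 hcon.1.symm, lt_of_le_of_ne hp1.1.2 hcon.2.1⟩, hp0,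
          lt_of_le_of_ne hp1.2.2 hcon.2.2⟩
      have h1 := harc p hp1.1 hp0 hp1.2.2 hcase
      have h2 := hζΔ.2
      rw [mem_ball, Complex.dist_eq] at h2
      rw [hGp] at h1
      linarith
  refine ⟨c0, hc00, fun ζ h1 h2 => ?_⟩
  obtain ⟨w, hw, hwe⟩ := hsubset ⟨h1, by rw [mem_ball, Complex.dist_eq]; exact h2⟩
  exact ⟨w, hVsub hw, hwe⟩

lemma antitone_of_int {φ φ' : ℝ → ℝ} {a b : ℝ} (hc : ContinuousOn φ (Icc a b))
    (h : ∀ u ∈ Ioo a b, HasDerivAt φ (φ' u) u) (h0 : ∀ u ∈ Ioo a b, φ' u ≤ 0) :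
    AntitoneOn φ (Icc a b) := by
  apply antitoneOn_of_deriv_nonpos (convex_Icc a b) hc
  · intro u hu
    rw [interior_Icc] at hu
    exact (h u hu).differentiableAt.differentiableWithinAt
  · intro u hu
    rw [interior_Icc] at hu
    rw [(h u hu).deriv]
    exact h0 u hu

lemma pos_of_ne {φ : ℝ → ℝ} {a b : ℝ} (hc : ContinuousOn φ (Icc a b))
    (hne : ∀ u ∈ Icc a b, φ u ≠ 0) (ha : 0 < φ a) : ∀ u ∈ Icc a b, 0 < φ u := by
  intro u hu
  by_contra hcon
  push Not at hcon
  obtain ⟨v, hv, hv0⟩ := intermediate_value_Icc' hu.1 (hc.mono (Icc_subset_Icc_right hu.2))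
    (show (0:ℝ) ∈ Icc (φ u) (φ a) from ⟨hcon, ha.le⟩)
  exact hne v ⟨hv.1, hv.2.trans hu.2⟩ hv0

/-- Contraction for two solutions of the real Loewner equation. -/
lemma contraction {X Y lam : ℝ → ℝ} {s t b R : ℝ} (hst : s < t) (htb : t ≤ b)
    (hX : ContinuousOn X (Icc s b)) (hY : ContinuousOn Y (Icc s b))
    (hl : ContinuousOn lam (Icc s b))
    (hXn : ∀ u ∈ Icc s b, X u ≠ lam u) (hYn : ∀ u ∈ Icc s b, Y u ≠ lam u)
    (hXd : ∀ u ∈ Ioo s b, HasDerivAt X (2 / (X u - lam u)) u)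
    (hYd : ∀ u ∈ Ioo s b, HasDerivAt Y (2 / (Y u - lam u)) u)
    (h0 : lam s < X s) (h1 : X s < Y s) (h2 : Y s ≤ lam s + R / 2) (hR : 0 < R)
    (ht : lam t = lam s + R) :
    |Y b - X b| ≤ (Y s - X s) * Real.exp (-(R ^ 2 / (8 * (t - s)))) := by
  have hp : ∀ u ∈ Icc s b, 0 < X u - lam u :=
    pos_of_ne (hX.sub hl) (fun u hu => sub_ne_zero.2 (hXn u hu)) (by simpa using h0)
  have hq : ∀ u ∈ Icc s b, 0 < Y u - lam u :=
    pos_of_ne (hY.sub hl) (fun u hu => sub_ne_zero.2 (hYn u hu)) (by simp; linarith)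
  have hsb : s ≤ b := hst.le.trans htb
  obtain ⟨u0, hu0, hmin⟩ := isCompact_Icc.exists_isMinOn (nonempty_Icc.2 hsb)
    ((hX.sub hl).mul (hY.sub hl))
  set c := (X u0 - lam u0) * (Y u0 - lam u0) with hc
  have hc0 : 0 < c := mul_pos (hp u0 hu0) (hq u0 hu0)
  have hcm : ∀ u ∈ Icc s b, c ≤ (X u - lam u) * (Y u - lam u) := fun u hu => hmin hu
  have hDd : ∀ u ∈ Ioo s b, HasDerivAt (fun u => Y u - X u)
      (-(2 * (Y u - X u) / ((X u - lam u) * (Y u - lam u)))) u := by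
    intro u hu
    have hu' : u ∈ Icc s b := ⟨hu.1.le, hu.2.le⟩
    have hp1 := (hp u hu').ne'
    have hq1 := (hq u hu').ne'
    have e : -(2 * (Y u - X u) / ((X u - lam u) * (Y u - lam u)))
        = 2 / (Y u - lam u) - 2 / (X u - lam u) := by
      field_simp
      ring
    rw [e]
    exact (hYd u hu).fun_sub (hXd u hu)
  have hDc : ContinuousOn (fun u => Y u - X u) (Icc s b) := hY.sub hX
  have hDne : ∀ u ∈ Icc s b, Y u - X u ≠ 0 := by
    have anti : AntitoneOn (fun u => -((Y u - X u) ^ 2 * Real.exp (4 / c * u))) (Icc s b) := by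
      apply antitone_of_int
      · exact ((hDc.pow 2).mul (by fun_prop)).neg
      · intro u hu
        exact (((hDd u hu).fun_pow 2).mul (((hasDerivAt_id u).const_mul (4 / c)).exp)).fun_neg
      · intro u hu
        have hu' : u ∈ Icc s b := ⟨hu.1.le, hu.2.le⟩
        have hP := hcm u hu'
        set P := (X u - lam u) * (Y u - lam u) with hPdef
        have hP0 : 0 < P := hc0.trans_le hP
        have h4 : 4 / P ≤ 4 / c := by gcongr
        have hE := Real.exp_pos (4 / c * u)
        simp only [id]
        have : -(((2:ℕ):ℝ) * (Y u - X u) ^ (2 - 1) * -(2 * (Y u - X u) / P) * Real.exp (4 / c * u) +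
            (Y u - X u) ^ 2 * (Real.exp (4 / c * u) * (4 / c * 1))) =
            -((Y u - X u) ^ 2 * Real.exp (4 / c * u) * (4 / c - 4 / P)) := by
          push_cast
          field_simp
          ring
        rw [this]
        have : 0 ≤ (Y u - X u) ^ 2 * Real.exp (4 / c * u) * (4 / c - 4 / P) :=
          mul_nonneg (by positivity) (by linarith)
        linarith
    intro u hu h0
    have := anti ⟨le_rfl, hsb⟩ hu hu.1
    simp only [h0] at this
    have : 0 < (Y s - X s) ^ 2 * Real.exp (4 / c * s) := by
      have : 0 < Y s - X s := by linarith
      positivity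
    simp at *
    linarith
  have hD : ∀ u ∈ Icc s b, 0 < Y u - X u := pos_of_ne hDc hDne (by simpa using h1)
  have hδ : 0 < t - s := by linarith
  have htm : t ∈ Icc s b := ⟨hst.le, htb⟩
  set a := R / (4 * (t - s)) with ha
  have ha0 : 0 < a := by positivity
  have anti1 : AntitoneOn (fun u => (Y u - X u) * Real.exp (2 * a * Y u - 2 * a ^ 2 * u)) (Icc s t) := by
    have hsub : Icc s t ⊆ Icc s b := Icc_subset_Icc_right htb
    have hY' := hY.mono hsub
    have hX' := hX.mono hsub
    apply antitone_of_int
    · fun_prop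
    · intro u hu
      have hu' : u ∈ Ioo s b := ⟨hu.1, hu.2.trans_le htb⟩
      exact (hDd u hu').mul ((((hYd u hu').const_mul (2 * a)).fun_sub
        ((hasDerivAt_id u).const_mul (2 * a ^ 2))).exp)
    · intro u hu
      have hu' : u ∈ Icc s b := ⟨hu.1.le, hu.2.le.trans htb⟩
      have p0 := hp u hu'
      have q0 := hq u hu'
      have D0 := hD u hu'
      simp only [id]
      set E := Real.exp (2 * a * Y u - 2 * a ^ 2 * u) with hE
      have hE0 : 0 < E := Real.exp_pos _
      set p := X u - lam u with hpd
      set q := Y u - lam u with hqd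
      have hpq : p ≤ q := by linarith
      have e : -(2 * (Y u - X u) / (p * q)) * E + (Y u - X u) * (E * (2 * a * (2 / q) - 2 * a ^ 2 * 1))
          = (Y u - X u) * E * (-(2 / (p * q)) + 4 * a / q - 2 * a ^ 2) := by
        field_simp
        ring
      rw [e]
      apply mul_nonpos_of_nonneg_of_nonpos (by positivity)
      have e1 : 2 / (q * q) ≤ 2 / (p * q) := by gcongr
      have e2 : -(2 / (q * q)) + 4 * a / q - 2 * a ^ 2 = -2 * (1 / q - a) ^ 2 := by
        field_simp
        ring
      nlinarith [sq_nonneg (1 / q - a)]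
  have anti2 : AntitoneOn (fun u => Y u - X u) (Icc t b) := by
    apply antitone_of_int (hDc.mono (Icc_subset_Icc_left hst.le))
      (fun u hu => hDd u ⟨hst.trans hu.1, hu.2⟩)
    intro u hu
    have hu' : u ∈ Icc s b := ⟨(hst.trans hu.1).le, hu.2.le⟩
    have p0 := hp u hu'
    have q0 := hq u hu'
    have D0 := hD u hu'
    have : 0 ≤ 2 * (Y u - X u) / ((X u - lam u) * (Y u - lam u)) := by positivity
    linarith
  have r1 := anti1 ⟨le_rfl, hst.le⟩ ⟨hst.le, le_rfl⟩ hst.le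
  have r2 := anti2 ⟨le_rfl, htb⟩ ⟨htb, le_rfl⟩ htb
  dsimp only at r1 r2
  rw [abs_of_pos (hD b ⟨hsb, le_rfl⟩)]
  refine r2.trans ?_
  have hYt : R / 2 ≤ Y t - Y s := by
    have := hq t htm
    linarith
  have r3 : Y t - X t ≤ (Y s - X s) * Real.exp ((2 * a * Y s - 2 * a ^ 2 * s) -
      (2 * a * Y t - 2 * a ^ 2 * t)) := by
    rw [Real.exp_sub, ← mul_div_assoc, le_div_iff₀ (Real.exp_pos _)]
    exact r1
  refine r3.trans ?_
  have hDs := hD s ⟨le_rfl, hsb⟩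
  gcongr
  have : 2 * a * Y s - 2 * a ^ 2 * s - (2 * a * Y t - 2 * a ^ 2 * t)
      = -(2 * a * (Y t - Y s)) + 2 * a ^ 2 * (t - s) := by ring
  rw [this]
  have e3 : -(R ^ 2 / (8 * (t - s))) = -(2 * a * (R / 2)) + 2 * a ^ 2 * (t - s) := by
    rw [ha]; field_simp; ring
  rw [e3]
  gcongr

section
variable {T : ℝ} {γ : ℝ → ℂ} {f g : ℝ → ℂ → ℂ} {lam : ℝ → ℝ}

lemma LC.free_strip (h : LC T γ f g lam) {s κ : ℝ} (hs : s ∈ Ico 0 T) (hκ : 0 < κ) :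
    ∃ m > 0, ∀ w : ℂ, 0 < w.im → w.im < m → κ < |w.re - lam s| → f s w ∉ γ '' Ioc 0 T := by
  have hs' : s ∈ Icc 0 T := ⟨hs.1, hs.2.le⟩
  obtain ⟨e, he, hB⟩ := h.tip_tendsto hs hκ
  obtain ⟨m, hm, hmin⟩ : ∃ m > 0, ∀ u ∈ Icc (s + e / 2) T, m ≤ (g s (γ u)).im := by
    rcases lt_or_ge T (s + e / 2) with hlt | hle
    · exact ⟨1, one_pos, fun u hu => absurd (hu.1.trans hu.2) (not_le.2 hlt)⟩
    · have hmem : ∀ u ∈ Icc (s + e / 2) T, u ∈ Ioc 0 T ∧ s < u := fun u hu =>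
        ⟨⟨by linarith [hu.1, hs.1], hu.2⟩, by linarith [hu.1]⟩
      have hc : ContinuousOn (fun u => (g s (γ u)).im) (Icc (s + e / 2) T) := by
        intro u hu
        obtain ⟨h1, h2⟩ := hmem u hu
        have k1 := h.g_contAt hs' (h.γU u h1) (h.tip_notMem h2 h1)
        have k2 : ContinuousWithinAt γ (Icc (s + e / 2) T) u :=
          (h.γc u ⟨h1.1.le, h1.2⟩).mono (fun v hv => ⟨(hmem v hv).1.1.le, hv.2⟩)
        exact Complex.continuous_im.continuousAt.comp_continuousWithinAt
          (k1.comp_continuousWithinAt k2)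
      obtain ⟨u0, hu0, hm0⟩ := isCompact_Icc.exists_isMinOn (nonempty_Icc.2 hle) hc
      obtain ⟨h1, h2⟩ := hmem u0 hu0
      exact ⟨_, h.gU s hs' _ (h.γU u0 h1) (h.tip_notMem h2 h1), fun u hu => hm0 hu⟩
  refine ⟨m, hm, fun w hw0 hwm hwκ => ?_⟩
  rintro ⟨u, hu, huw⟩
  have hgw : g s (γ u) = w := by rw [huw]; exact h.gf s hs' w hw0
  have hsu : s < u := by
    by_contra hcon
    exact h.fK s hs' w hw0 ⟨u, ⟨hu.1, not_lt.1 hcon⟩, huw⟩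
  rcases lt_or_ge u (s + e) with h1 | h1
  · have := hB u ⟨hsu, h1⟩ hu.2
    rw [hgw] at this
    have h2 := Complex.abs_re_le_norm (w - (lam s : ℂ))
    simp only [Complex.sub_re, Complex.ofReal_re] at h2
    linarith
  · have := hmin u ⟨by linarith, hu.2⟩
    rw [hgw] at this
    linarith

/-- Existence and properties of boundary trajectories. -/
lemma LC.bdry (h : LC T γ f g lam) {s a b m : ℝ} (hs : s ∈ Ico 0 T) (hm : 0 < m)
    (hfree : ∀ w ∈ HR a b m, f s w ∉ γ '' Ioc 0 T) :
    ∃ X : ℝ → ℝ → ℝ,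
      (∀ u ∈ Icc s T, ∀ w ∈ HR (a + m / 2) (b - m / 2) (m / 2),
        ‖g u (f s w) - (X u w.re : ℂ)‖ ≤ 4 * w.im) ∧
      (∀ u ∈ Ico s T, ∀ x ∈ Ioo (a + m / 2) (b - m / 2), X u x ≠ lam u) := by
  have hs' : s ∈ Icc 0 T := ⟨hs.1, hs.2.le⟩
  have hd : ∀ u ∈ Icc s T, DifferentiableOn ℂ (fun w => g u (f s w)) (HR a b m) := by
    intro u hu w hw
    have hu' : u ∈ Icc 0 T := ⟨hs.1.trans hu.1, hu.2⟩
    have hwU : w ∈ UHP := hw.2.1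
    have k1 := h.g_diffAt hu' (h.fU s hs' w hwU) (LC.notMem_mono hu.2 (hfree w hw))
    have k2 := (h.fd s hs').differentiableAt (isOpen_UHP.mem_nhds hwU)
    exact (DifferentiableAt.comp w k1 k2).differentiableWithinAt
  have hp : ∀ u ∈ Icc s T, ∀ w ∈ HR a b m, 0 < (g u (f s w)).im := by
    intro u hu w hw
    exact h.gU u ⟨hs.1.trans hu.1, hu.2⟩ _ (h.fU s hs' w hw.2.1)
      (LC.notMem_mono hu.2 (hfree w hw))
  have hi : ∀ u ∈ Icc s T, ∀ w ∈ HR a b m, (g u (f s w)).im ≤ w.im := by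
    intro u hu w hw
    have hF := (h.flow (h.fU s hs' w hw.2.1) le_rfl (hfree w hw)).im_anti
    have := hF hs' (show u ∈ Icc 0 T from ⟨hs.1.trans hu.1, hu.2⟩) hu.1
    simpa [h.gf s hs' w hw.2.1] using this
  have hex : ∀ u, ∃ X : ℝ → ℝ, u ∈ Icc s T → ∀ w ∈ HR (a + m / 2) (b - m / 2) (m / 2),
        ‖g u (f s w) - (X w.re : ℂ)‖ ≤ 4 * w.im := by
    intro u
    by_cases hu : u ∈ Icc s T
    · obtain ⟨X, hX⟩ := exists_bdry (m' := m / 2) (by linarith) (hd u hu) (hp u hu) (hi u hu)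
      exact ⟨X, fun _ => hX⟩
    · exact ⟨0, fun h => absurd h hu⟩
  choose X hX using hex
  refine ⟨X, hX, ?_⟩
  intro u hu x hx heq
  have hu' : u ∈ Icc s T := ⟨hu.1, hu.2.le⟩
  have hu0 : u ∈ Icc 0 T := ⟨hs.1.trans hu.1, hu.2.le⟩
  have hsub : HR (a + m / 2) (b - m / 2) (m / 2) ⊆ HR a b m := fun w hw =>
    ⟨⟨by linarith [hw.1.1], by linarith [hw.1.2]⟩, hw.2.1, by linarith [hw.2.2]⟩
  obtain ⟨c, hc, hopen⟩ := bdry_open (by linarith : 0 < m / 2) ((hd u hu').mono hsub)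
    (fun w hw => hp u hu' w (hsub hw)) (fun w hw => hi u hu' w (hsub hw)) (hX u hu') hx.1 hx.2
  obtain ⟨e, he, hB⟩ := h.tip_tendsto (u₀ := u) ⟨hu0.1, hu.2⟩ hc
  have hmin1 : min e (T - u) ≤ e := min_le_left _ _
  have hmin2 : min e (T - u) ≤ T - u := min_le_right _ _
  have hmin0 : 0 < min e (T - u) := lt_min he (by linarith [hu.2])
  set v := u + min e (T - u) / 2 with hv
  have hv0 : v ∈ Ioc 0 T := ⟨by linarith [hu0.1], by linarith⟩
  have huv : u < v := by linarith
  have hBv := hB v ⟨huv, by linarith⟩ hv0.2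
  rw [← heq] at hBv
  have hnot := h.tip_notMem huv hv0
  obtain ⟨w, hw, hwe⟩ := hopen _ (h.gU u hu0 _ (h.γU v hv0) hnot) hBv
  have hfw := hfree w (hsub hw)
  have := h.g_inj hu0 (h.fU s hs' w hw.2.1) (LC.notMem_mono hu'.2 hfw) (h.γU v hv0) hnot hwe
  exact hfw ⟨v, hv0, this.symm⟩

/-- Regularity of boundary trajectories. -/
lemma LC.bdry_reg (h : LC T γ f g lam) {s m x : ℝ} {X : ℝ → ℝ} (hs : s ∈ Ico 0 T) (hm : 0 < m)
    (hfree : ∀ η ∈ Ioo 0 m, f s ⟨x, η⟩ ∉ γ '' Ioc 0 T)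
    (hX : ∀ u ∈ Icc s T, ∀ η ∈ Ioo 0 m, ‖g u (f s ⟨x, η⟩) - (X u : ℂ)‖ ≤ 4 * η)
    (hne : ∀ u ∈ Ico s T, X u ≠ lam u) :
    X s = x ∧ ContinuousOn X (Icc s T) ∧
      ∀ u ∈ Ioo s T, HasDerivAt X (2 / (X u - lam u)) u := by
  have hs' : s ∈ Icc 0 T := ⟨hs.1, hs.2.le⟩
  have hflow : ∀ η ∈ Ioo 0 m, FlowOn (fun u => g u (f s ⟨x, η⟩)) lam (Icc 0 T) := fun η hη =>
    h.flow (h.fU s hs' _ hη.1) le_rfl (hfree η hη)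
  have hev : ∀ᶠ η in nhdsWithin (0:ℝ) (Ioi 0), η ∈ Ioo 0 m := Ioo_mem_nhdsGT hm
  have hunif : TendstoUniformlyOn (fun (η : ℝ) u => g u (f s ⟨x, η⟩)) (fun u => (X u : ℂ))
      (nhdsWithin (0:ℝ) (Ioi 0)) (Icc s T) := by
    rw [Metric.tendstoUniformlyOn_iff]
    intro ε hε
    have : ∀ᶠ η in nhdsWithin (0:ℝ) (Ioi 0), η ∈ Ioo 0 (ε / 4) := Ioo_mem_nhdsGT (by linarith)
    filter_upwards [hev, this] with η h1 h2 u hu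
    rw [dist_comm, Complex.dist_eq]
    have := hX u hu η h1
    linarith [h2.2]
  have hXc : ContinuousOn (fun u => (X u : ℂ)) (Icc s T) := by
    apply hunif.continuousOn
    apply Eventually.frequently
    filter_upwards [hev] with η hη
    exact (hflow η hη).contOn.mono (Icc_subset_Icc_left hs.1)
  have hXc' : ContinuousOn X (Icc s T) := by
    have := Complex.continuous_re.comp_continuousOn hXc
    exact this
  refine ⟨?_, hXc', ?_⟩
  · have ha : ∀ η ∈ Ioo 0 m, |x - X s| ≤ 4 * η := by
      intro η hη
      have h1 := hX s ⟨le_rfl, hs.2.le⟩ η hη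
      rw [h.gf s hs' _ hη.1] at h1
      have h2 := Complex.abs_re_le_norm ((⟨x, η⟩ : ℂ) - (X s : ℂ))
      simp only [Complex.sub_re, Complex.ofReal_re] at h2
      exact h2.trans h1
    by_contra hcon
    have hpos : 0 < |x - X s| := abs_pos.2 (sub_ne_zero.2 (fun h => hcon h.symm))
    set η := min (m / 2) (|x - X s| / 8) with hη
    have h1 : η ≤ m / 2 := min_le_left _ _
    have h2 : η ≤ |x - X s| / 8 := min_le_right _ _
    have h3 : 0 < η := lt_min (by linarith) (by linarith)
    have := ha η ⟨h3, by linarith⟩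
    linarith
  · intro u hu
    -- a compact neighbourhood
    set a := (s + u) / 2 with ha
    set b := (u + T) / 2 with hb
    have hsa : s < a := by linarith [hu.1]
    have hau : a < u := by linarith [hu.1]
    have hub : u < b := by linarith [hu.2]
    have hbT : b < T := by linarith [hu.2]
    have hsub : Icc a b ⊆ Icc s T := Icc_subset_Icc hsa.le hbT.le
    obtain ⟨c, hc, hcX⟩ : ∃ c > 0, ∀ v ∈ Icc a b, c ≤ |X v - lam v| := by
      have hcont : ContinuousOn (fun v => |X v - lam v|) (Icc a b) :=
        ((hXc'.mono hsub).sub (h.lc.mono (hsub.trans (Icc_subset_Icc_left hs.1)))).abs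
      obtain ⟨v0, hv0, hmin⟩ := isCompact_Icc.exists_isMinOn
        (nonempty_Icc.2 (hau.trans hub).le) hcont
      refine ⟨_, abs_pos.2 (sub_ne_zero.2 (hne v0 ⟨by linarith [hv0.1], by linarith [hv0.2]⟩)),
        fun v hv => hmin hv⟩
    have hder : TendstoUniformlyOn (fun (η : ℝ) v => 2 / (g v (f s ⟨x, η⟩) - (lam v : ℂ)))
        (fun v => 2 / ((X v : ℂ) - (lam v : ℂ))) (nhdsWithin (0:ℝ) (Ioi 0)) (Ioo a b) := by
      rw [Metric.tendstoUniformlyOn_iff]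
      intro ε hε
      have h1 : ∀ᶠ η in nhdsWithin (0:ℝ) (Ioi 0), η ∈ Ioo 0 (min (c / 8) (ε * c ^ 2 / 32)) :=
        Ioo_mem_nhdsGT (lt_min (by positivity) (by positivity))
      filter_upwards [hev, h1] with η hη hη2 v hv
      have hv' : v ∈ Icc a b := ⟨hv.1.le, hv.2.le⟩
      have k1 : η < c / 8 := hη2.2.trans_le (min_le_left _ _)
      have k2 : η < ε * c ^ 2 / 32 := hη2.2.trans_le (min_le_right _ _)
      have k3 := hX v (hsub hv') η hη
      set A := (X v : ℂ) - (lam v : ℂ) with hA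
      set B := g v (f s ⟨x, η⟩) - (lam v : ℂ) with hB
      have hAn : c ≤ ‖A‖ := by
        rw [hA, ← Complex.ofReal_sub, Complex.norm_real, Real.norm_eq_abs]
        exact hcX v hv'
      have hBA : ‖B - A‖ ≤ 4 * η := by
        have : B - A = g v (f s ⟨x, η⟩) - (X v : ℂ) := by rw [hA, hB]; ring
        rw [this]; exact k3
      have hBn : c / 2 ≤ ‖B‖ := by
        have : ‖A‖ ≤ ‖B‖ + ‖B - A‖ := by
          calc ‖A‖ = ‖B - (B - A)‖ := by congr 1; ring
            _ ≤ _ := norm_sub_le _ _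
        linarith
      have hA0 : A ≠ 0 := norm_pos_iff.1 (hc.trans_le hAn)
      have hB0 : B ≠ 0 := norm_pos_iff.1 (lt_of_lt_of_le (by linarith) hBn)
      have hη0 := hη.1
      rw [Complex.dist_eq]
      have : 2 / A - 2 / B = 2 * (B - A) / (A * B) := by field_simp
      rw [this, norm_div, norm_mul, norm_mul, Complex.norm_ofNat]
      calc 2 * ‖B - A‖ / (‖A‖ * ‖B‖) ≤ 2 * (4 * η) / (c * (c / 2)) := by gcongr
        _ = 16 * η / c ^ 2 := by field_simp; ring
        _ < 16 * (ε * c ^ 2 / 32) / c ^ 2 := by gcongr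
        _ = ε / 2 := by field_simp; ring
        _ < ε := by linarith
    have hcx : HasDerivAt (fun u => (X u : ℂ)) (2 / ((X u : ℂ) - (lam u : ℂ))) u := by
      refine hasDerivAt_of_tendstoUniformlyOn (f := fun (η : ℝ) u => g u (f s ⟨x, η⟩))
        isOpen_Ioo hder ?_ ?_ ⟨hau, hub⟩
      · filter_upwards [hev] with η hη v hv
        exact ((hflow η hη) v ⟨by linarith [hs.1, hv.1], by linarith [hv.2]⟩).2
      · intro v hv
        exact hunif.tendsto_at ⟨by linarith [hv.1], by linarith [hv.2]⟩
    have := (Complex.reCLM.hasFDerivAt (x := (X u : ℂ))).comp_hasDerivAt u hcx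
    have e : Complex.reCLM (2 / ((X u : ℂ) - (lam u : ℂ))) = 2 / (X u - lam u) := by
      have : (2 / ((X u : ℂ) - (lam u : ℂ))) = ((2 / (X u - lam u) : ℝ) : ℂ) := by push_cast; rfl
      rw [this, Complex.reCLM_apply, Complex.ofReal_re]
    rw [e] at this
    exact this
end

lemma contraction_sigma {X Y lam : ℝ → ℝ} {s t b R σ : ℝ} (hσ : σ = 1 ∨ σ = -1) (hst : s < t)
    (htb : t ≤ b)
    (hX : ContinuousOn X (Icc s b)) (hY : ContinuousOn Y (Icc s b))
    (hl : ContinuousOn lam (Icc s b))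
    (hXn : ∀ u ∈ Icc s b, X u ≠ lam u) (hYn : ∀ u ∈ Icc s b, Y u ≠ lam u)
    (hXd : ∀ u ∈ Ioo s b, HasDerivAt X (2 / (X u - lam u)) u)
    (hYd : ∀ u ∈ Ioo s b, HasDerivAt Y (2 / (Y u - lam u)) u)
    (h0 : 0 < σ * (X s - lam s)) (h1 : σ * (X s - lam s) < σ * (Y s - lam s))
    (h2 : σ * (Y s - lam s) ≤ R / 2) (hR : 0 < R)
    (ht : lam t - lam s = σ * R) :
    |Y b - X b| ≤ |Y s - X s| * Real.exp (-(R ^ 2 / (8 * (t - s)))) := by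
  rcases hσ with rfl | rfl
  · rw [abs_of_pos (by linarith : 0 < Y s - X s)]
    exact contraction hst htb hX hY hl hXn hYn hXd hYd (by linarith) (by linarith) (by linarith) hR
      (by linarith)
  · have hder : ∀ Z : ℝ → ℝ, (∀ u ∈ Ioo s b, HasDerivAt Z (2 / (Z u - lam u)) u) →
        ∀ u ∈ Ioo s b, HasDerivAt (fun u => -Z u) (2 / (-Z u - -lam u)) u := by
      intro Z hZ u hu
      have e : 2 / (-Z u - -lam u) = -(2 / (Z u - lam u)) := by
        rw [← div_neg]; congr 1; ring
      rw [e]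
      exact (hZ u hu).fun_neg
    have := contraction (X := fun u => -X u) (Y := fun u => -Y u) (lam := fun u => -lam u) (R := R)
      hst htb hX.neg hY.neg hl.neg (fun u hu => by simpa using hXn u hu)
      (fun u hu => by simpa using hYn u hu) (hder X hXd) (hder Y hYd)
      (by linarith) (by linarith) (by linarith) hR (by linarith)
    have e1 : |Y b - X b| = |-Y b - -X b| := by
      rw [← abs_neg]; congr 1; ring
    have e2 : |Y s - X s| = -Y s - -X s := by
      rw [abs_of_neg (by linarith)]; ring
    rw [e1, e2]
    exact this

section
variable {T : ℝ} {γ : ℝ → ℂ} {f g : ℝ → ℂ → ℂ} {lam : ℝ → ℝ}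

/-- The boundary interval on the moving side is strongly contracted at time `T`. -/
lemma LC.flat (h : LC T γ f g lam) {s t R σ : ℝ} (hs : s ∈ Ico 0 T) (hσ : σ = 1 ∨ σ = -1)
    (ht : t ∈ Ioo s T) (hR : 0 < R) (hRl : lam t - lam s = σ * R) :
    ∃ η₀ > 0, ∀ η ∈ Ioo 0 η₀, ∀ x x' : ℝ, σ * (x - lam s) ∈ Icc (R / 4) (R / 2) →
      σ * (x' - lam s) ∈ Icc (R / 4) (R / 2) →
      f s ⟨x, η⟩ ∉ γ '' Ioc 0 T ∧ f s ⟨x', η⟩ ∉ γ '' Ioc 0 T ∧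
      ‖g T (f s ⟨x, η⟩) - g T (f s ⟨x', η⟩)‖ ≤ R / 2 * Real.exp (-(R ^ 2 / (8 * (t - s)))) := by
  have hs' : s ∈ Icc 0 T := ⟨hs.1, hs.2.le⟩
  obtain ⟨m0, hm0, hfree0⟩ := h.free_strip hs (by linarith : 0 < R / 16)
  set m := min m0 (R / 16) with hm
  have hmm0 : m ≤ m0 := min_le_left _ _
  have hmR : m ≤ R / 16 := min_le_right _ _
  have hmpos : 0 < m := lt_min hm0 (by linarith)
  -- the rectangle
  obtain ⟨a, b, hab1, hab2⟩ : ∃ a b : ℝ, (∀ x, a < x → x < b → R / 16 < |x - lam s|) ∧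
      (∀ x, σ * (x - lam s) ∈ Icc (R / 4) (R / 2) → x ∈ Ioo (a + m / 2) (b - m / 2)) := by
    rcases hσ with rfl | rfl
    · refine ⟨lam s + R / 8, lam s + R, fun x h1 h2 => ?_, fun x hx => ⟨?_, ?_⟩⟩
      · exact lt_of_lt_of_le (by linarith) (le_abs_self _)
      · linarith [hx.1]
      · linarith [hx.2]
    · refine ⟨lam s - R, lam s - R / 8, fun x h1 h2 => ?_, fun x hx => ⟨?_, ?_⟩⟩
      · exact lt_of_lt_of_le (by linarith) (neg_le_abs _)
      · linarith [hx.2]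
      · linarith [hx.1]
  have hfree : ∀ w ∈ HR a b m, f s w ∉ γ '' Ioc 0 T := fun w hw =>
    hfree0 w hw.2.1 (hw.2.2.trans_le hmm0) (hab1 _ hw.1.1 hw.1.2)
  obtain ⟨X, hX1, hX2⟩ := h.bdry hs hmpos hfree
  have hreg : ∀ x, σ * (x - lam s) ∈ Icc (R / 4) (R / 2) →
      X s x = x ∧ ContinuousOn (fun u => X u x) (Icc s T) ∧
      ∀ u ∈ Ioo s T, HasDerivAt (fun u => X u x) (2 / (X u x - lam u)) u := by
    intro x hx
    have hx' := hab2 x hx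
    refine h.bdry_reg (X := fun u => X u x) hs (by linarith : 0 < m / 2) ?_ ?_ ?_
    · intro η hη
      exact hfree _ ⟨⟨by dsimp only; linarith [hx'.1], by dsimp only; linarith [hx'.2]⟩, hη.1,
        by dsimp only; linarith [hη.2]⟩
    · intro u hu η hη
      exact hX1 u hu ⟨x, η⟩ ⟨hx', hη⟩
    · exact fun u hu => hX2 u hu x hx'
  set E := Real.exp (-(R ^ 2 / (8 * (t - s)))) with hE
  have hE0 : 0 < E := Real.exp_pos _
  have hlt : ∀ x x' : ℝ, σ * (x - lam s) ∈ Icc (R / 4) (R / 2) →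
      σ * (x' - lam s) ∈ Icc (R / 4) (R / 2) → σ * (x - lam s) < σ * (x' - lam s) →
      |X T x' - X T x| ≤ |x' - x| * E := by
    intro x x' hx hx' hxx
    obtain ⟨i1, i2, i3⟩ := hreg x hx
    obtain ⟨j1, j2, j3⟩ := hreg x' hx'
    have hb : ∀ b ∈ Ico t T, |X b x' - X b x| ≤ |x' - x| * E := by
      intro b hb
      have hsub : Icc s b ⊆ Icc s T := Icc_subset_Icc_right hb.2.le
      have := contraction_sigma (X := fun u => X u x) (Y := fun u => X u x') (lam := lam) (R := R)
        (b := b)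
        hσ ht.1 hb.1 (i2.mono hsub) (j2.mono hsub)
        (h.lc.mono (hsub.trans (Icc_subset_Icc_left hs.1)))
        (fun u hu => hX2 u ⟨hu.1, hu.2.trans_lt hb.2⟩ x (hab2 x hx))
        (fun u hu => hX2 u ⟨hu.1, hu.2.trans_lt hb.2⟩ x' (hab2 x' hx'))
        (fun u hu => i3 u ⟨hu.1, hu.2.trans hb.2⟩)
        (fun u hu => j3 u ⟨hu.1, hu.2.trans hb.2⟩)
        (by rw [i1]; linarith [hx.1]) (by rw [i1, j1]; exact hxx)
        (by rw [j1]; exact hx'.2) hR hRl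
      rw [i1, j1] at this
      exact this
    have hT : T ∈ Icc s T := ⟨hs.2.le, le_rfl⟩
    have hfil : nhdsWithin T (Iio T) ≤ nhdsWithin T (Icc s T) :=
      nhdsWithin_le_of_mem (Icc_mem_nhdsLT hs.2)
    have l1 := ((j2 T hT).tendsto.sub (i2 T hT).tendsto).abs.mono_left hfil
    refine le_of_tendsto l1 ?_
    filter_upwards [Ico_mem_nhdsLT ht.2] with b hb' using hb b hb'
  have hall : ∀ x x' : ℝ, σ * (x - lam s) ∈ Icc (R / 4) (R / 2) →
      σ * (x' - lam s) ∈ Icc (R / 4) (R / 2) → |X T x - X T x'| ≤ R / 4 * E := by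
    intro x x' hx hx'
    have hd : |x - x'| ≤ R / 4 := by
      have : |σ * (x - lam s) - σ * (x' - lam s)| ≤ R / 4 := by
        rw [abs_le]; exact ⟨by linarith [hx.1, hx'.2], by linarith [hx.2, hx'.1]⟩
      have e : σ * (x - lam s) - σ * (x' - lam s) = σ * (x - x') := by ring
      rw [e, abs_mul] at this
      have hσ1 : |σ| = 1 := by rcases hσ with rfl | rfl <;> simp
      rw [hσ1] at this
      linarith
    rcases lt_trichotomy (σ * (x - lam s)) (σ * (x' - lam s)) with hh | hh | hh
    · have := hlt x x' hx hx' hh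
      rw [abs_sub_comm] at this
      refine this.trans ?_
      rw [abs_sub_comm]
      gcongr
    · have : x = x' := by rcases hσ with rfl | rfl <;> linarith
      rw [this]; simp; positivity
    · refine (hlt x' x hx' hx hh).trans ?_
      gcongr
  refine ⟨min (m / 2) (R / 4 * E / 8), lt_min (by linarith) (by positivity), ?_⟩
  intro η hη x x' hx hx'
  have hη1 : η < m / 2 := hη.2.trans_le (min_le_left _ _)
  have hη2 : η < R / 4 * E / 8 := hη.2.trans_le (min_le_right _ _)
  have k := hab2 x hx
  have k' := hab2 x' hx'
  have hT : T ∈ Icc s T := ⟨hs.2.le, le_rfl⟩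
  refine ⟨hfree _ ⟨⟨by dsimp only; linarith [k.1], by dsimp only; linarith [k.2]⟩, hη.1,
        by dsimp only; linarith⟩, hfree _ ⟨⟨by dsimp only; linarith [k'.1], by dsimp only; linarith [k'.2]⟩, hη.1,
        by dsimp only; linarith⟩, ?_⟩
  have q := hX1 T hT ⟨x, η⟩ ⟨k, hη.1, hη1⟩
  have q' := hX1 T hT ⟨x', η⟩ ⟨k', hη.1, hη1⟩
  dsimp only at q q'
  have q2 := hall x x' hx hx'
  have e1 : ‖((X T x : ℂ)) - (X T x' : ℂ)‖ = |X T x - X T x'| := by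
    rw [← Complex.ofReal_sub, Complex.norm_real, Real.norm_eq_abs]
  have : ‖g T (f s ⟨x, η⟩) - g T (f s ⟨x', η⟩)‖ ≤ ‖g T (f s ⟨x, η⟩) - (X T x : ℂ)‖ +
      ‖((X T x : ℂ)) - (X T x' : ℂ)‖ + ‖g T (f s ⟨x', η⟩) - (X T x' : ℂ)‖ := by
    calc _ = ‖(g T (f s ⟨x, η⟩) - (X T x : ℂ)) + (((X T x : ℂ)) - (X T x' : ℂ)) -
          (g T (f s ⟨x', η⟩) - (X T x' : ℂ))‖ := by congr 1; ring
      _ ≤ _ := (norm_sub_le _ _).trans (by gcongr; exact norm_add_le _ _)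
  rw [e1] at this
  linarith

/-- Oscillation bound for `f s` near the boundary interval. -/
lemma LC.osc (h : LC T γ f g lam) {s t R σ β C₀ : ℝ} (hs : s ∈ Ico 0 T) (hσ : σ = 1 ∨ σ = -1)
    (ht : t ∈ Ioo s T) (hR : 0 < R) (hRl : lam t - lam s = σ * R) (hβ : 0 < β) (hC : 0 < C₀)
    (hH : IsHolder (f T) β C₀) :
    ∃ η₀ > 0, ∀ η ∈ Ioo 0 η₀, ∀ x x' : ℝ, σ * (x - lam s) ∈ Icc (R / 4) (R / 2) →
      σ * (x' - lam s) ∈ Icc (R / 4) (R / 2) →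
      ‖f s ⟨x, η⟩ - f s ⟨x', η⟩‖ ≤ C₀ * max ((R / 2 * Real.exp (-(R ^ 2 / (8 * (t - s))))) ^ β)
        (R / 2 * Real.exp (-(R ^ 2 / (8 * (t - s))))) := by
  have hs' : s ∈ Icc 0 T := ⟨hs.1, hs.2.le⟩
  have hT : T ∈ Icc 0 T := ⟨hs.1.trans hs.2.le, le_rfl⟩
  obtain ⟨η₀, hη₀, hf⟩ := h.flat hs hσ ht hR hRl
  refine ⟨η₀, hη₀, fun η hη x x' hx hx' => ?_⟩
  obtain ⟨n1, n2, n3⟩ := hf η hη x x' hx hx'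
  have u1 : f s ⟨x, η⟩ ∈ UHP := h.fU s hs' _ hη.1
  have u2 : f s ⟨x', η⟩ ∈ UHP := h.fU s hs' _ hη.1
  have := hH _ (h.gU T hT _ u1 n1) _ (h.gU T hT _ u2 n2)
  rw [h.fg T hT _ u1 n1, h.fg T hT _ u2 n2, Complex.dist_eq, Complex.dist_eq] at this
  refine this.trans ?_
  gcongr
end

lemma max_bound {r q β : ℝ} (hr : 0 < r) (hq : 0 ≤ q) (hβ : 0 < β) (hβ1 : β ≤ 1) :
    max ((r * Real.exp (-q)) ^ β) (r * Real.exp (-q)) ≤ max r 1 * Real.exp (-(β * q)) := by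
  have he : Real.exp (-q) ≤ Real.exp (-(β * q)) := by
    apply Real.exp_le_exp.2; nlinarith
  apply max_le
  · rw [Real.mul_rpow hr.le (Real.exp_pos _).le, ← Real.exp_mul]
    have e1 : -q * β = -(β * q) := by ring
    rw [e1]
    gcongr
    rcases le_total r 1 with h | h
    · exact (Real.rpow_le_one hr.le h hβ.le).trans (le_max_right _ _)
    · calc r ^ β ≤ r ^ (1:ℝ) := Real.rpow_le_rpow_of_exponent_le h hβ1
        _ = r := Real.rpow_one r
        _ ≤ _ := le_max_left _ _
  · gcongr
    exact le_max_left _ _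

lemma calculus_end {A β δ R : ℝ} (hA : 0 < A) (hβ : 0 < β) (hδ : 0 < δ) (hδ1 : δ ≤ 1 / 2)
    (hR : 0 < R) (h : R ^ 8 ≤ A * Real.exp (-(β * (R ^ 2 / (8 * δ))))) :
    R ≤ Real.sqrt (2 + 8 / β * (2 * |Real.log A| + 4)) * Real.sqrt (δ * Real.log (1 / δ)) := by
  have hL : 1 / 2 ≤ Real.log (1 / δ) := by
    have h2 : Real.log 2 ≤ Real.log (1 / δ) := by
      apply Real.log_le_log (by norm_num)
      rw [le_div_iff₀ hδ]; linarith
    linarith [Real.log_two_gt_d9]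
  set L := Real.log (1 / δ) with hLd
  rw [← Real.sqrt_mul (by positivity)]
  apply Real.le_sqrt_of_sq_le
  have hk : 0 ≤ 8 / β * (2 * |Real.log A| + 4) := by positivity
  have hδL : 0 ≤ δ * L := by positivity
  rcases le_total (R ^ 2) δ with hc | hc
  · nlinarith
  · have h4 : δ ^ 4 ≤ R ^ 8 := by
      calc δ ^ 4 ≤ (R ^ 2) ^ 4 := by gcongr
        _ = R ^ 8 := by ring
    have h5 := h4.trans h
    have h6 := Real.log_le_log (by positivity) h5
    rw [Real.log_mul hA.ne' (Real.exp_pos _).ne', Real.log_exp, Real.log_pow] at h6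
    have hLd' : Real.log δ = -L := by rw [hLd, one_div, Real.log_inv]; ring
    rw [hLd'] at h6
    push_cast at h6
    have h7 : β * (R ^ 2 / (8 * δ)) ≤ (2 * |Real.log A| + 4) * L := by
      have := le_abs_self (Real.log A)
      nlinarith [abs_nonneg (Real.log A)]
    have h8 : R ^ 2 = 8 * δ / β * (β * (R ^ 2 / (8 * δ))) := by field_simp
    have h9 : R ^ 2 ≤ 8 * δ / β * ((2 * |Real.log A| + 4) * L) := by
      rw [h8]; gcongr
    have h10 : 8 * δ / β * ((2 * |Real.log A| + 4) * L) =
        8 / β * (2 * |Real.log A| + 4) * (δ * L) := by ring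
    nlinarith

section
variable {T : ℝ} {γ : ℝ → ℂ} {f g : ℝ → ℂ → ℂ} {lam : ℝ → ℝ}

lemma sigma_exists (d : ℝ) : ∃ σ : ℝ, (σ = 1 ∨ σ = -1) ∧ d = σ * |d| := by
  rcases abs_choice d with h | h
  · exact ⟨1, Or.inl rfl, by rw [h, one_mul]⟩
  · exact ⟨-1, Or.inr rfl, by rw [h]; ring⟩

lemma LC.bound0 (h : LC T γ f g lam) {t β C₀ : ℝ} (hβ : 0 < β) (hβ1 : β ≤ 1) (hC : 0 < C₀)
    (hH : IsHolder (f T) β C₀) (ht : t ∈ Ico 0 T) :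
    |lam t - lam 0| ≤ 2 + 8 * T / β * |Real.log (2 * C₀)| := by
  have hT : 0 < T := ht.1.trans_lt ht.2
  have hpos : 0 ≤ 8 * T / β * |Real.log (2 * C₀)| := by positivity
  by_contra hcon
  push Not at hcon
  obtain ⟨σ, hσ, hRl⟩ := sigma_exists (lam t - lam 0)
  set R := |lam t - lam 0| with hRd
  have hR2 : 2 < R := by linarith
  have hR : 0 < R := by linarith
  have ht0 : 0 < t := by
    rcases ht.1.eq_or_lt with h0 | h0
    · rw [← h0] at hRd; simp at hRd; linarith
    · exact h0
  obtain ⟨η₀, hη₀, ho⟩ := h.osc ⟨le_rfl, hT⟩ hσ ⟨ht0, ht.2⟩ hR hRl hβ hC hH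
  have hσ2 : σ * σ = 1 := by rcases hσ with rfl | rfl <;> norm_num
  have hσ1 : |σ| = 1 := by rcases hσ with rfl | rfl <;> simp
  have e : ∀ k, σ * (lam 0 + σ * k - lam 0) = k := fun k => by
    have : σ * (lam 0 + σ * k - lam 0) = σ * σ * k := by ring
    rw [this, hσ2, one_mul]
  have key := ho (η₀ / 2) ⟨by linarith, by linarith⟩ (lam 0 + σ * (R / 2)) (lam 0 + σ * (R / 4))
    (by rw [e]; exact ⟨by linarith, le_rfl⟩) (by rw [e]; exact ⟨le_rfl, by linarith⟩)
  have h00 : (0:ℝ) ∈ Icc 0 T := ⟨le_rfl, hT.le⟩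
  have hid : ∀ z ∈ UHP, f 0 z = z := fun z hz => by
    rw [← h.g0 _ (h.fU 0 h00 z hz), h.gf 0 h00 z hz]
  have hη2 : 0 < η₀ / 2 := by linarith
  rw [hid _ hη2, hid _ hη2] at key
  have hnorm : ‖(⟨lam 0 + σ * (R / 2), η₀ / 2⟩ : ℂ) - ⟨lam 0 + σ * (R / 4), η₀ / 2⟩‖ = R / 4 := by
    have : (⟨lam 0 + σ * (R / 2), η₀ / 2⟩ : ℂ) - ⟨lam 0 + σ * (R / 4), η₀ / 2⟩ =
        ((σ * (R / 4) : ℝ) : ℂ) := by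
      apply Complex.ext
      · simp; ring
      · simp
    rw [this, Complex.norm_real, Real.norm_eq_abs, abs_mul, hσ1, one_mul, abs_of_pos (by linarith)]
  rw [hnorm, sub_zero] at key
  have mb := max_bound (r := R / 2) (q := R ^ 2 / (8 * t)) (by linarith) (by positivity) hβ hβ1
  rw [max_eq_left (by linarith : 1 ≤ R / 2)] at mb
  have k2 : R / 4 ≤ C₀ * (R / 2 * Real.exp (-(β * (R ^ 2 / (8 * t))))) :=
    key.trans (by gcongr)
  have k3 : 1 ≤ 2 * C₀ * Real.exp (-(β * (R ^ 2 / (8 * t)))) := by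
    have : R / 4 * 1 ≤ R / 4 * (2 * C₀ * Real.exp (-(β * (R ^ 2 / (8 * t))))) := by linarith
    exact le_of_mul_le_mul_left this (by linarith)
  have k4 := Real.log_le_log one_pos k3
  rw [Real.log_one, Real.log_mul (by positivity) (Real.exp_pos _).ne', Real.log_exp] at k4
  have k5 : β * (R ^ 2 / (8 * t)) ≤ |Real.log (2 * C₀)| := by
    linarith [le_abs_self (Real.log (2 * C₀))]
  have k6 : R ^ 2 = 8 * t / β * (β * (R ^ 2 / (8 * t))) := by field_simp
  have k7 : R ^ 2 ≤ 8 * T / β * |Real.log (2 * C₀)| := by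
    rw [k6]
    gcongr
    exact ht.2.le
  nlinarith

lemma LC.main_est (h : LC T γ f g lam) {s t β C₀ B : ℝ} (hβ : 0 < β) (hβ1 : β ≤ 1) (hC : 0 < C₀)
    (hH : IsHolder (f T) β C₀) (hB0 : 0 < B) (hB : ∀ u ∈ Ico 0 T, |lam u - lam 0| ≤ B)
    (hs : 0 ≤ s) (hst : s < t) (htT : t < T) (hne : lam t ≠ lam s) :
    |lam t - lam s| ^ 8 ≤ (2 ^ 32 * C₀ * (5 * B + T + 1) ^ 8) *
      Real.exp (-(β * (|lam t - lam s| ^ 2 / (8 * (t - s))))) := by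
  have hs1 : s ∈ Ico 0 T := ⟨hs, hst.trans htT⟩
  have hs' : s ∈ Icc 0 T := ⟨hs, hs1.2.le⟩
  have hT : 0 < T := hs.trans_lt hs1.2
  obtain ⟨σ, hσ, hRl⟩ := sigma_exists (lam t - lam s)
  set R := |lam t - lam s| with hRd
  have hR : 0 < R := abs_pos.2 (sub_ne_zero.2 hne)
  have hRB : R ≤ 2 * B := by
    have h1 := hB t ⟨hs.trans hst.le, htT⟩
    have h2 := hB s hs1
    rw [hRd]
    rw [abs_le] at *
    constructor <;> linarith
  obtain ⟨η₀, hη₀, ho⟩ := h.osc hs1 hσ ⟨hst, htT⟩ hR hRl hβ hC hH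
  set ε := C₀ * max ((R / 2 * Real.exp (-(R ^ 2 / (8 * (t - s))))) ^ β)
        (R / 2 * Real.exp (-(R ^ 2 / (8 * (t - s))))) with hε
  have hδ : 0 < t - s := by linarith
  have hε0 : 0 ≤ ε := by
    have : 0 ≤ R / 2 * Real.exp (-(R ^ 2 / (8 * (t - s)))) := by positivity
    exact mul_nonneg hC.le (this.trans (le_max_right _ _))
  set M := 5 * B + T + 1 with hM
  have hM0 : 0 < M := by positivity
  have hεM : ε ≤ C₀ * (M * Real.exp (-(β * (R ^ 2 / (8 * (t - s)))))) := by
    have mb := max_bound (r := R / 2) (q := R ^ 2 / (8 * (t - s))) (by linarith) (by positivity)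
      hβ hβ1
    have : max (R / 2) 1 ≤ M := max_le (by linarith) (by linarith)
    rw [hε]
    gcongr
    exact mb.trans (by gcongr)
  have hσ2 : σ * σ = 1 := by rcases hσ with rfl | rfl <;> norm_num
  have hσ1 : |σ| = 1 := by rcases hσ with rfl | rfl <;> simp
  -- choose the height
  set η := min (η₀ / 2) (R / 8) with hη
  have hη1 : η ≤ η₀ / 2 := min_le_left _ _
  have hη2 : η ≤ R / 8 := min_le_right _ _
  have hη0 : 0 < η := lt_min (by linarith) (by linarith)
  set ρ := R / 16 with hρ
  -- size bounds
  have hlam : ∀ u ∈ Icc 0 s, lam 0 - 2 * B ≤ lam u ∧ lam u ≤ lam 0 + 2 * B := by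
    intro u hu
    have := hB u ⟨hu.1, hu.2.trans_lt hs1.2⟩
    rw [abs_le] at this
    exact ⟨by linarith, by linarith⟩
  have hsize : ∀ z : ℂ, 0 < z.im → z.im ≤ R / 4 → |z.re - lam s| ≤ R / 2 →
      (lam 0 - 2 * B ≤ (f s z).re ∧ (f s z).re ≤ lam 0 + 2 * B) ∧
      0 < (f s z).im ∧ (f s z).im ≤ B + T + 1 := by
    intro z h1 h2 h3
    have hls := hB s hs1
    rw [abs_le] at h3 hls
    refine ⟨⟨?_, ?_⟩, h.fU s hs' z h1, ?_⟩
    · exact h.le_f_re hs' h1 (fun u hu => (hlam u hu).1) (by linarith)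
    · exact h.f_re_le hs' h1 (fun u hu => (hlam u hu).2) (by linarith)
    · have := h.f_im_sq hs' h1
      have hz : z.im ^ 2 ≤ B ^ 2 := by
        have : z.im ≤ B := by linarith
        gcongr
      apply abs_le_of_sq_le_sq' _ (by positivity) |>.2
      nlinarith [sq_nonneg (T - 1), hs1.2]
  set w0 := f s ⟨lam s + σ * (3 * R / 8), η⟩ with hw0
  have hmem : ∀ k, R / 4 ≤ k → k ≤ R / 2 →
      σ * (lam s + σ * k - lam s) ∈ Icc (R / 4) (R / 2) := fun k h1 h2 => by
    have : σ * (lam s + σ * k - lam s) = σ * σ * k := by ring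
    rw [this, hσ2, one_mul]; exact ⟨h1, h2⟩
  have hw0s := hsize ⟨lam s + σ * (3 * R / 8), η⟩ hη0 (by dsimp only; linarith) (by
    dsimp only
    rw [add_sub_cancel_left, abs_mul, hσ1, one_mul, abs_of_pos (by linarith)]; linarith)
  rw [← hw0] at hw0s
  have hsq : ∀ k, (k = 5 * R / 16 ∨ k = 7 * R / 16) →
      ‖f s ⟨lam s + σ * k, ρ + η⟩ - w0‖ ^ 4 ≤ ε * M ^ 3 := by
    intro k hk
    have hk1 : R / 4 + ρ ≤ k ∧ k ≤ R / 2 - ρ := by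
      rcases hk with rfl | rfl <;> constructor <;> linarith
    set c : ℂ := ⟨lam s + σ * k, ρ + η⟩ with hc
    have hin : ∀ z : ℂ, |z.re| ≤ ρ → (c + z).re = lam s + σ * (k + σ * z.re) ∧
        R / 4 ≤ k + σ * z.re ∧ k + σ * z.re ≤ R / 2 := by
      intro z hz
      have : |σ * z.re| ≤ ρ := by rw [abs_mul, hσ1, one_mul]; exact hz
      rw [abs_le] at this
      refine ⟨?_, by linarith, by linarith⟩
      rw [Complex.add_re]
      calc lam s + σ * k + z.re = lam s + σ * k + 1 * z.re := by ring
        _ = lam s + σ * k + σ * σ * z.re := by rw [hσ2]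
        _ = _ := by ring
    have him : ∀ z : ℂ, |z.im| ≤ ρ → 0 < (c + z).im ∧ (c + z).im ≤ R / 4 := by
      intro z hz
      rw [abs_le] at hz
      rw [Complex.add_im]
      have : c.im = ρ + η := rfl
      rw [this]
      constructor <;> linarith
    refine square_bound (F := fun z => f s z - w0) (by linarith : 0 < ρ) hε0 ?_ ?_ ?_
    · intro z h1 h2
      exact ((h.fd s hs').differentiableAt (isOpen_UHP.mem_nhds (him z h2).1)).sub_const _
    · intro z h1 h2
      obtain ⟨i1, i2, i3⟩ := hin z h1
      have q := hsize (c + z) (him z h2).1 (him z h2).2 (by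
        rw [i1, add_sub_cancel_left, abs_mul, hσ1, one_mul, abs_of_pos (by linarith)]; exact i3)
      refine (Complex.norm_le_abs_re_add_abs_im _).trans ?_
      rw [Complex.sub_re, Complex.sub_im]
      have b1 : |(f s (c + z)).re - w0.re| ≤ 4 * B := by
        rw [abs_le]; constructor <;> linarith [q.1.1, q.1.2, hw0s.1.1, hw0s.1.2]
      have b2 : |(f s (c + z)).im - w0.im| ≤ B + T + 1 := by
        rw [abs_le]; constructor <;> linarith [q.2.1, q.2.2, hw0s.2.1, hw0s.2.2]
      linarith
    · intro z h1 h2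
      obtain ⟨i1, i2, i3⟩ := hin z h1
      have e : c + z = ⟨lam s + σ * (k + σ * z.re), η⟩ := by
        apply Complex.ext
        · exact i1
        · rw [Complex.add_im, h2]
          have : c.im = ρ + η := rfl
          rw [this]; dsimp only; ring
      rw [e]
      exact ho η ⟨hη0, by linarith⟩ _ _ (hmem _ i2 i3) (hmem _ (by linarith) (by linarith))
  have s1 := hsq _ (Or.inl rfl)
  have s2 := hsq _ (Or.inr rfl)
  set c1 : ℂ := ⟨lam s + σ * (5 * R / 16), ρ + η⟩ with hc1
  set c2 : ℂ := ⟨lam s + σ * (7 * R / 16), ρ + η⟩ with hc2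
  have hρη : 0 < ρ + η := by positivity
  have hlow := h.lower hs' (z := c2) (z' := c1) hρη hρη
  have hcc : ‖c2 - c1‖ = R / 8 := by
    have : c2 - c1 = ((σ * (R / 8) : ℝ) : ℂ) := by
      apply Complex.ext
      · simp [hc1, hc2]; ring
      · simp [hc1, hc2]
    rw [this, Complex.norm_real, Real.norm_eq_abs, abs_mul, hσ1, one_mul, abs_of_pos (by linarith)]
  have q1 := hsize c1 hρη (by
    change ρ + η ≤ R / 4; linarith) (by
    change |lam s + σ * (5 * R / 16) - lam s| ≤ R / 2
    rw [add_sub_cancel_left, abs_mul, hσ1, one_mul, abs_of_pos (by linarith)]; linarith)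
  have q2 := hsize c2 hρη (by
    change ρ + η ≤ R / 4; linarith) (by
    change |lam s + σ * (7 * R / 16) - lam s| ≤ R / 2
    rw [add_sub_cancel_left, abs_mul, hσ1, one_mul, abs_of_pos (by linarith)]; linarith)
  have hi1 : c1.im = ρ + η := rfl
  have hi2 : c2.im = ρ + η := rfl
  rw [hcc, hi1] at hlow
  set N := ‖f s c2 - f s c1‖ with hN
  have hN0 : 0 ≤ N := norm_nonneg _
  have hN4 : N ^ 4 ≤ 16 * (ε * M ^ 3) := by
    have htri : N ≤ ‖f s c2 - w0‖ + ‖f s c1 - w0‖ := by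
      calc N = ‖(f s c2 - w0) - (f s c1 - w0)‖ := by rw [hN]; congr 1; ring
        _ ≤ _ := norm_sub_le _ _
    have := add_pow_le (norm_nonneg (f s c2 - w0)) (norm_nonneg (f s c1 - w0)) 4
    calc N ^ 4 ≤ (‖f s c2 - w0‖ + ‖f s c1 - w0‖) ^ 4 := by gcongr
      _ ≤ 2 ^ (4 - 1) * (‖f s c2 - w0‖ ^ 4 + ‖f s c1 - w0‖ ^ 4) := this
      _ ≤ 16 * (ε * M ^ 3) := by norm_num; linarith
  have hlow2 : (R / 8) ^ 2 * (R / 16) ^ 2 ≤ N ^ 2 * M ^ 2 := by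
    calc (R / 8) ^ 2 * (R / 16) ^ 2 ≤ (R / 8) ^ 2 * ((ρ + η) * (ρ + η)) := by
          rw [sq (R / 16)]
          gcongr <;> linarith
      _ ≤ N ^ 2 * ((f s c2).im * (f s c1).im) := hlow
      _ ≤ N ^ 2 * (M * M) := by
          have := q1.2.1
          have := q2.2.1
          gcongr
          · linarith [q2.2.2]
          · linarith [q1.2.2]
      _ = _ := by ring
  have hfin : ((R / 8) ^ 2 * (R / 16) ^ 2) ^ 2 ≤ 16 * (ε * M ^ 3) * M ^ 4 := by
    calc ((R / 8) ^ 2 * (R / 16) ^ 2) ^ 2 ≤ (N ^ 2 * M ^ 2) ^ 2 := by gcongr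
      _ = N ^ 4 * M ^ 4 := by ring
      _ ≤ _ := by gcongr
  have hfin2 : R ^ 8 ≤ 2 ^ 32 * ε * M ^ 7 := by
    have : ((R / 8) ^ 2 * (R / 16) ^ 2) ^ 2 = R ^ 8 / 2 ^ 28 := by ring
    rw [this, div_le_iff₀ (by positivity)] at hfin
    calc R ^ 8 ≤ _ := hfin
      _ = _ := by ring
  calc R ^ 8 ≤ 2 ^ 32 * ε * M ^ 7 := hfin2
    _ ≤ 2 ^ 32 * (C₀ * (M * Real.exp (-(β * (R ^ 2 / (8 * (t - s))))))) * M ^ 7 := by gcongr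
    _ = _ := by ring
end

section
open Topology

lemma normSq_sub_conj (a b : ℂ) :
    ‖a - b‖ ^ 2 = ‖a - (starRingEnd ℂ) b‖ ^ 2 - 4 * (a.im * b.im) := by
  rw [← Complex.normSq_eq_norm_sq, ← Complex.normSq_eq_norm_sq, Complex.normSq_apply,
    Complex.normSq_apply]
  simp
  ring

lemma sub_conj_ne {a b : ℂ} (ha : 0 < a.im) (hb : 0 < b.im) : a - (starRingEnd ℂ) b ≠ 0 := by
  intro h
  have := congrArg Complex.im h
  simp at this
  linarith

/-- Schwarz-Pick lemma in the upper half-plane. -/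
lemma schwarz_pick {H : ℂ → ℂ} (hd : DifferentiableOn ℂ H UHP) (hU : ∀ z ∈ UHP, H z ∈ UHP)
    {z z0 : ℂ} (hz : z ∈ UHP) (hz0 : z0 ∈ UHP) :
    ‖H z - H z0‖ * ‖z - (starRingEnd ℂ) z0‖ ≤ ‖H z - (starRingEnd ℂ) (H z0)‖ * ‖z - z0‖ := by
  set c := (starRingEnd ℂ) z0 with hc
  set ψ : ℂ → ℂ := fun w => (z0 - c * w) / (1 - w) with hψ
  have hlt : ∀ w ∈ ball (0:ℂ) 1, 1 - w ≠ 0 := by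
    intro w hw h
    have : w = 1 := by linear_combination -h
    simp [this] at hw
  have hψU : ∀ w ∈ ball (0:ℂ) 1, ψ w ∈ UHP := by
    intro w hw
    have h1 := hlt w hw
    have hw1 : Complex.normSq w < 1 := by
      rw [Complex.normSq_eq_norm_sq]
      have : ‖w‖ < 1 := by simpa using hw
      nlinarith [norm_nonneg w]
    have : (ψ w).im = z0.im * (1 - Complex.normSq w) / Complex.normSq (1 - w) := by
      simp only [hψ, Complex.div_im, hc]
      simp [Complex.normSq_apply]
      ring
    change 0 < (ψ w).im
    rw [this]
    have h2 : 0 < z0.im := hz0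
    have h3 := Complex.normSq_pos.2 h1
    have : 0 < 1 - Complex.normSq w := by linarith
    positivity
  have hψd : DifferentiableOn ℂ ψ (ball 0 1) := by
    apply DifferentiableOn.div
    · fun_prop
    · fun_prop
    · exact hlt
  have hcp := hd.comp hψd hψU
  set q : ℂ → ℂ := fun w => (H (ψ w) - H z0) / (H (ψ w) - (starRingEnd ℂ) (H z0)) with hq
  have hH0 : 0 < (H z0).im := hU z0 hz0
  have hqd : DifferentiableOn ℂ q (ball 0 1) := by
    apply DifferentiableOn.div (hcp.sub_const _) (hcp.sub_const _)
    intro w hw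
    exact sub_conj_ne (hU _ (hψU w hw)) hH0
  have hq0 : q 0 = 0 := by simp [hq, hψ]
  have hqm : MapsTo q (ball 0 1) (ball 0 1) := by
    intro w hw
    have h1 : 0 < (H (ψ w)).im := hU _ (hψU w hw)
    have h2 := sub_conj_ne h1 hH0
    rw [mem_ball_zero_iff, norm_div, div_lt_one (norm_pos_iff.2 h2)]
    apply lt_of_pow_lt_pow_left₀ 2 (norm_nonneg _)
    rw [normSq_sub_conj]
    nlinarith [mul_pos h1 hH0]
  have hzc : z - c ≠ 0 := sub_conj_ne hz hz0
  have hzc0 := norm_pos_iff.2 hzc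
  have hw : ‖(z - z0) / (z - c)‖ < 1 := by
    rw [norm_div, div_lt_one hzc0]
    apply lt_of_pow_lt_pow_left₀ 2 (norm_nonneg _)
    rw [normSq_sub_conj]
    have h1 : 0 < z.im := hz
    have h2 : 0 < z0.im := hz0
    nlinarith [mul_pos h1 h2]
  have hψw : ψ ((z - z0) / (z - c)) = z := by
    have : z0 - c ≠ 0 := sub_conj_ne hz0 hz0
    have h1 : 1 - (z - z0) / (z - c) = (z0 - c) / (z - c) := by field_simp; ring
    simp only [hψ]
    rw [h1]
    field_simp
    ring
  have key := Complex.norm_le_norm_of_mapsTo_ball hqd (hqm.mono_right ball_subset_closedBall) hq0 hw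
  have h2 := norm_pos_iff.2 (sub_conj_ne (hU z hz) hH0)
  simp only [hq, hψw] at key
  rw [norm_div, norm_div, div_le_div_iff₀ h2 hzc0] at key
  linarith

/-- Lower bound for the imaginary part along a vertical line. -/
lemma im_lower {H : ℂ → ℂ} (hd : DifferentiableOn ℂ H UHP) (hU : ∀ z ∈ UHP, H z ∈ UHP)
    {x y y0 : ℝ} (hy : 0 < y) (hy0 : 0 < y0) :
    (H ⟨x, y0⟩).im * (y * y0) ≤ (H ⟨x, y⟩).im * (y + y0) ^ 2 := by
  have h := schwarz_pick hd hU (z := ⟨x, y⟩) (z0 := ⟨x, y0⟩) hy hy0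
  set a := H ⟨x, y⟩ with ha
  set b := H ⟨x, y0⟩ with hb
  have ha0 : 0 < a.im := hU _ hy
  have hb0 : 0 < b.im := hU _ hy0
  have h2 : (‖a - b‖ * ‖(⟨x, y⟩ : ℂ) - (starRingEnd ℂ) ⟨x, y0⟩‖) ^ 2 ≤
      (‖a - (starRingEnd ℂ) b‖ * ‖(⟨x, y⟩ : ℂ) - ⟨x, y0⟩‖) ^ 2 := by gcongr
  rw [mul_pow, mul_pow, normSq_sub_conj a b, normSq_sub_conj ⟨x, y⟩ ⟨x, y0⟩] at h2
  have e : ‖(⟨x, y⟩ : ℂ) - (starRingEnd ℂ) ⟨x, y0⟩‖ ^ 2 = (y + y0) ^ 2 := by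
    rw [← Complex.normSq_eq_norm_sq, Complex.normSq_apply]; simp; ring
  rw [e] at h2
  dsimp only at h2
  have e2 : b.im ^ 2 ≤ ‖a - (starRingEnd ℂ) b‖ ^ 2 := by
    have := Complex.abs_im_le_norm (a - (starRingEnd ℂ) b)
    have h3 : b.im ≤ ‖a - (starRingEnd ℂ) b‖ := by
      refine le_trans ?_ ((le_abs_self _).trans this)
      simp; linarith
    gcongr
  have h4 : b.im ^ 2 * (y * y0) ≤ b.im * (a.im * (y + y0) ^ 2) := by
    nlinarith [mul_le_mul_of_nonneg_right e2 (mul_pos hy hy0).le]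
  have : b.im * (b.im * (y * y0)) ≤ b.im * (a.im * (y + y0) ^ 2) := by linarith
  exact le_of_mul_le_mul_left this hb0

/-- The hydrodynamic map increases imaginary parts. -/
lemma im_le_of_hydro {f : ℂ → ℂ} (hd : DifferentiableOn ℂ f UHP) (hU : ∀ z ∈ UHP, f z ∈ UHP)
    (hl : Tendsto (fun z => f z - z) (cobounded ℂ ⊓ 𝓟 UHP) (nhds (0 : ℂ))) {z : ℂ}
    (hz : z ∈ UHP) : z.im ≤ (f z).im := by
  apply le_of_forall_pos_le_add
  intro ε hε
  have hz0 : 0 < z.im := hz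
  set η := min ε (z.im / 2) with hη
  have hη0 : 0 < η := by positivity
  have hηz : η < z.im := by
    have := min_le_right ε (z.im / 2)
    linarith
  have hηε : η ≤ ε := min_le_left _ _
  have hev := hl (Metric.ball_mem_nhds 0 hη0)
  rw [mem_map, mem_inf_principal] at hev
  obtain ⟨r, -, hr⟩ := (hasBasis_cobounded_norm.mem_iff).1 hev
  set r' := max r (‖z‖ + 1) with hr'
  have hrr : r ≤ r' := le_max_left _ _
  have hzr : ‖z‖ < r' := by
    have := le_max_right r (‖z‖ + 1)
    linarith
  set U : Set ℂ := {w | η < w.im} ∩ ball 0 r' with hUdef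
  have hUo : IsOpen U := (isOpen_lt continuous_const Complex.continuous_im).inter isOpen_ball
  have hcl : closure U ⊆ {w | η ≤ w.im} ∩ closedBall 0 r' := by
    apply closure_minimal
    · rintro w ⟨h1, h2⟩
      exact ⟨(show η < w.im from h1).le, ball_subset_closedBall h2⟩
    · exact (isClosed_le continuous_const Complex.continuous_im).inter isClosed_closedBall
  have hclU : closure U ⊆ UHP := fun w hw => lt_of_lt_of_le hη0 (hcl hw).1
  have hdd : DifferentiableOn ℂ (fun w => Complex.exp (I * (f w - w))) UHP :=
    ((hd.sub differentiableOn_id).const_mul I).cexp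
  have hnorm : ∀ w : ℂ, ‖Complex.exp (I * (f w - w))‖ = Real.exp (w.im - (f w).im) := by
    intro w
    rw [Complex.norm_exp]
    congr 1
    simp
  have key := Complex.norm_le_of_forall_mem_frontier_norm_le (U := U)
    (isBounded_ball.subset inter_subset_right) (hdd.mono hclU).diffContOnCl (C := Real.exp η)
    (by
      intro w hw
      rw [hUo.frontier_eq] at hw
      have h1 := hcl hw.1
      have h0 : 0 < (f w).im := hU w (hclU hw.1)
      rw [hnorm, Real.exp_le_exp]
      by_cases h2 : w.im ≤ η
      · linarith
      · have h3 : r' ≤ ‖w‖ := by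
          by_contra h3
          exact hw.2 ⟨not_le.1 h2, by simpa using h3⟩
        have h4 := hr (show w ∈ {x | r ≤ ‖x‖} from hrr.trans h3) (hclU hw.1)
        have h5 : ‖f w - w‖ < η := by simpa using h4
        have h6 := (abs_le.1 (Complex.abs_im_le_norm (f w - w))).1
        rw [Complex.sub_im] at h6
        linarith) (z := z) (subset_closure ⟨hηz, by simpa using hzr⟩)
  rw [hnorm, Real.exp_le_exp] at key
  linarith

/-- The map of the empty hull is the identity. -/
lemma hydro_empty {f : ℂ → ℂ} (hd : DifferentiableOn ℂ f UHP) (hU : ∀ z ∈ UHP, f z ∈ UHP)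
    (hl : Tendsto (fun z => f z - z) (cobounded ℂ ⊓ 𝓟 UHP) (nhds (0 : ℂ)))
    (hcap : Tendsto (fun z => z * (z - f z)) (cobounded ℂ ⊓ 𝓟 UHP) (nhds (0 : ℂ))) {z : ℂ}
    (hz : z ∈ UHP) : f z = z := by
  have him : ∀ z ∈ UHP, (f z - z).im = 0 := by
    rintro ⟨x, y0⟩ hz
    have hy0 : 0 < y0 := hz
    have hb := im_le_of_hydro hd hU hl hz
    set b := (f ⟨x, y0⟩ - ⟨x, y0⟩).im with hbdef
    have hb0 : 0 ≤ b := by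
      rw [hbdef, Complex.sub_im]; linarith
    by_contra hne
    have hbp : 0 < b := lt_of_le_of_ne hb0 (Ne.symm hne)
    have hstep : ∀ y, 0 < y → b * (y * y0) ≤ (f ⟨x, y⟩ - ⟨x, y⟩).im * (y + y0) ^ 2 := by
      intro y hy
      apply le_of_forall_pos_le_add
      intro ε hε
      set δ := ε / (y + y0) ^ 2 with hδ
      have hδ0 : 0 < δ := by positivity
      have := im_lower (H := fun w => f w - w + δ * I)
        ((hd.sub differentiableOn_id).add_const _) (by
          intro w hw
          have := im_le_of_hydro hd hU hl hw
          change 0 < (f w - w + δ * I).im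
          simp
          linarith) (x := x) hy hy0
      simp only [Complex.add_im (_ - _)] at this
      rw [← hbdef] at this
      have e : ((δ : ℂ) * I).im = δ := by simp
      rw [e] at this
      have e2 : δ * (y + y0) ^ 2 = ε := by rw [hδ]; field_simp
      nlinarith [mul_pos hδ0 (mul_pos hy hy0)]
    have hε : 0 < b * y0 / 5 := by positivity
    have hev := hcap (Metric.ball_mem_nhds 0 hε)
    rw [mem_map, mem_inf_principal] at hev
    obtain ⟨r, -, hr⟩ := (hasBasis_cobounded_norm.mem_iff).1 hev
    set y := max r y0 with hy
    have hry : r ≤ y := le_max_left _ _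
    have hyy : y0 ≤ y := le_max_right _ _
    have hyp : 0 < y := by linarith
    have hyn : y ≤ ‖(⟨x, y⟩ : ℂ)‖ := (le_abs_self _).trans (Complex.abs_im_le_norm ⟨x, y⟩)
    have h4 := hr (show (⟨x, y⟩ : ℂ) ∈ {x | r ≤ ‖x‖} from hry.trans hyn) (show 0 < y from hyp)
    have h5 : ‖(⟨x, y⟩ : ℂ)‖ * ‖(⟨x, y⟩ : ℂ) - f ⟨x, y⟩‖ < b * y0 / 5 := by
      rw [← norm_mul]; simpa only [mem_preimage, mem_ball_zero_iff] using h4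
    have h6 : (f ⟨x, y⟩ - ⟨x, y⟩).im ≤ ‖(⟨x, y⟩ : ℂ) - f ⟨x, y⟩‖ := by
      rw [norm_sub_rev]
      exact (le_abs_self _).trans (Complex.abs_im_le_norm _)
    have h7 : y * (f ⟨x, y⟩ - ⟨x, y⟩).im ≤ b * y0 / 5 := by
      calc y * (f ⟨x, y⟩ - ⟨x, y⟩).im ≤ y * ‖(⟨x, y⟩ : ℂ) - f ⟨x, y⟩‖ := by gcongr
        _ ≤ ‖(⟨x, y⟩ : ℂ)‖ * ‖(⟨x, y⟩ : ℂ) - f ⟨x, y⟩‖ := by gcongr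
        _ ≤ _ := h5.le
    have h8 := hstep y hyp
    have h9 : y * (b * (y * y0)) ≤ b * y0 / 5 * (4 * y ^ 2) := by
      calc y * (b * (y * y0)) ≤ y * ((f ⟨x, y⟩ - ⟨x, y⟩).im * (y + y0) ^ 2) := by gcongr
        _ = (y * (f ⟨x, y⟩ - ⟨x, y⟩).im) * (y + y0) ^ 2 := by ring
        _ ≤ b * y0 / 5 * (y + y0) ^ 2 := by gcongr
        _ ≤ b * y0 / 5 * (4 * y ^ 2) := by
          gcongr
          nlinarith
    nlinarith [mul_pos (mul_pos hbp hy0) (mul_pos hyp hyp)]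
  have hcv : Convex ℝ UHP := convex_halfSpace_im_gt 0
  have hcon : IsConnected UHP := ⟨⟨z, hz⟩, hcv.isPreconnected⟩
  obtain ⟨c, hc⟩ := ((hd.sub differentiableOn_id).analyticOnNhd isOpen_UHP).eq_const_of_im_eq_const
    him isOpen_UHP hcon
  have hcz : c = 0 := by
    by_contra hne
    have hp := norm_pos_iff.2 hne
    have hev := hl (Metric.ball_mem_nhds 0 hp)
    rw [mem_map, mem_inf_principal] at hev
    obtain ⟨r, -, hr⟩ := (hasBasis_cobounded_norm.mem_iff).1 hev
    set y := max r 1 with hy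
    have hry : r ≤ y := le_max_left _ _
    have hyp : 0 < y := lt_of_lt_of_le one_pos (le_max_right _ _)
    have hyn : y ≤ ‖(⟨0, y⟩ : ℂ)‖ := (le_abs_self _).trans (Complex.abs_im_le_norm ⟨0, y⟩)
    have h4 := hr (show (⟨0, y⟩ : ℂ) ∈ {x | r ≤ ‖x‖} from hry.trans hyn) (show 0 < y from hyp)
    have h5 : f ⟨0, y⟩ - ⟨0, y⟩ = c := hc ⟨0, y⟩ hyp
    rw [mem_preimage, mem_ball_zero_iff, h5] at h4
    exact lt_irrefl _ h4
  have : f z - z = c := hc z hz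
  rw [hcz] at this
  exact sub_eq_zero.1 this

end

/-- If a geometric Loewner chain generated by a simple curve has a
final complementary domain which is a `(β, C₀)`-Hölder domain, then its driving
function has modulus of continuity `C √(|s-t| log(1/|s-t|))`. -/
theorem loewner_holder_simple_curve (β C₀ T : ℝ) (hβ0 : 0 < β) (hβ1 : β ≤ 1)
    (hC₀ : 0 < C₀) (hT : 0 ≤ T) :
    ∃ C > 0, ∀ (γ : ℝ → ℂ) (K : ℝ → Set ℂ) (f g : ℝ → ℂ → ℂ) (lam : ℝ → ℝ),
      ContinuousOn γ (Icc 0 T) → InjOn γ (Icc 0 T) →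
      (γ 0).im = 0 → (∀ t ∈ Ioc (0:ℝ) T, γ t ∈ UHP) →
      (∀ t ∈ Icc (0:ℝ) T, K t = γ '' Ioc 0 t) →
      (∀ t ∈ Icc (0:ℝ) T, IsHull (K t)) →
      (∀ t ∈ Icc (0:ℝ) T, IsHydroPair (K t) (f t) (g t)) →
      (∀ t ∈ Icc (0:ℝ) T, HasHcap (K t) (f t) (2 * t)) →
      ContinuousOn lam (Icc 0 T) →
      (∀ z ∈ UHP, ∀ t ∈ Icc (0:ℝ) T, z ∉ K t →
        HasDerivAt (fun s : ℝ => g s z) (2 / (g t z - (lam t : ℂ))) t) →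
      IsHolder (f T) β C₀ →
      ∀ s ∈ Icc (0:ℝ) T, ∀ t ∈ Icc (0:ℝ) T, 0 < |s - t| → |s - t| ≤ 1/2 →
        |lam s - lam t| ≤ C * Real.sqrt (|s - t| * Real.log (1 / |s - t|)) := by
  set B : ℝ := 2 + 8 * T / β * |Real.log (2 * C₀)| with hB
  have hB0 : 0 < B := by positivity
  set A : ℝ := 2 ^ 32 * C₀ * (5 * B + T + 1) ^ 8 with hA
  have hA0 : 0 < A := by positivity
  refine ⟨√(2 + 8 / β * (2 * |Real.log A| + 4)), by positivity, ?_⟩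
  set C : ℝ := √(2 + 8 / β * (2 * |Real.log A| + 4)) with hC
  intro γ K f g lam hγc hγi hγ0 hγU hK hhull hpair hcap hlc hode hH
  have hL : LC T γ f g lam := by
    refine
      { γc := hγc
        γU := hγU
        γi := hγi
        fd := fun t ht => (hpair t ht).1.1
        fU := fun t ht z hz => ?_
        fK := fun t ht z hz => ?_
        gU := fun t ht w hw hwK => ?_
        fg := fun t ht w hw hwK => ?_
        gf := fun t ht z hz => (hpair t ht).2.1 hz
        lc := hlc
        ode := fun z hz t ht hzK => hode z hz t ht (by rw [hK t ht]; exact hzK)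
        g0 := fun w hw => ?_ }
    · have : f t z ∈ UHP \ K t := by rw [← (hpair t ht).1.2.2.1]; exact mem_image_of_mem _ hz
      exact this.1
    · have : f t z ∈ UHP \ K t := by rw [← (hpair t ht).1.2.2.1]; exact mem_image_of_mem _ hz
      rw [← hK t ht]
      exact this.2
    · have : w ∈ f t '' UHP := by
        rw [(hpair t ht).1.2.2.1]; exact ⟨hw, by rw [hK t ht]; exact hwK⟩
      obtain ⟨z, hz, rfl⟩ := this
      rw [(hpair t ht).2.1 hz]
      exact hz
    · exact (hpair t ht).2.2 ⟨hw, by rw [hK t ht]; exact hwK⟩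
    · have h0 : (0:ℝ) ∈ Icc 0 T := ⟨le_rfl, hT⟩
      have hU : ∀ z ∈ UHP, f 0 z ∈ UHP := fun z hz => by
        have : f 0 z ∈ UHP \ K 0 := by rw [← (hpair 0 h0).1.2.2.1]; exact mem_image_of_mem _ hz
        exact this.1
      have hc := hcap 0 h0
      unfold HasHcap at hc
      have := hydro_empty (hpair 0 h0).1.1 hU (hpair 0 h0).1.2.2.2 (by simpa using hc) hw
      have h2 := (hpair 0 h0).2.1 hw
      rwa [this] at h2
  have hbd : ∀ u ∈ Ico (0:ℝ) T, |lam u - lam 0| ≤ B := fun u hu =>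
    hL.bound0 hβ0 hβ1 hC₀ hH hu
  have hinter : ∀ s t, 0 ≤ s → s < t → t < T → t - s ≤ 1 / 2 →
      |lam t - lam s| ≤ C * √((t - s) * Real.log (1 / (t - s))) := by
    intro s t hs hst htT hh
    by_cases hne : lam t = lam s
    · rw [hne, sub_self, abs_zero]; positivity
    · exact calculus_end hA0 hβ0 (sub_pos.2 hst) hh (abs_pos.2 (sub_ne_zero.2 hne))
        (hL.main_est hβ0 hβ1 hC₀ hH hB0 hbd hs hst htT hne)
  have hall : ∀ s t, 0 ≤ s → s < t → t ≤ T → t - s ≤ 1 / 2 →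
      |lam t - lam s| ≤ C * √((t - s) * Real.log (1 / (t - s))) := by
    intro s t hs hst htT hh
    rcases htT.lt_or_eq with h | rfl
    · exact hinter s t hs hst h hh
    · have hcl : Tendsto (fun u => |lam u - lam s|) (nhdsWithin t (Iio t))
          (nhds |lam t - lam s|) := by
        have h1 : Tendsto lam (nhdsWithin t (Iio t)) (nhds (lam t)) :=
          (hlc t ⟨hT, le_rfl⟩).mono_left
            (nhdsWithin_le_of_mem (Icc_mem_nhdsLT (by linarith)))
        exact (h1.sub_const _).abs
      have hcr : Tendsto (fun u => C * √((u - s) * Real.log (1 / (u - s))))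
          (nhdsWithin t (Iio t)) (nhds (C * √((t - s) * Real.log (1 / (t - s))))) := by
        have hne : t - s ≠ 0 := (sub_pos.2 hst).ne'
        have : ContinuousAt (fun u => C * √((u - s) * Real.log (1 / (u - s)))) t := by
          have h1 : ContinuousAt (fun u : ℝ => u - s) t := by fun_prop
          have h2 : ContinuousAt (fun u : ℝ => 1 / (u - s)) t := continuousAt_const.div h1 hne
          exact continuousAt_const.mul (h1.mul (h2.log (one_div_ne_zero hne))).sqrt
        exact this.tendsto.mono_left nhdsWithin_le_nhds
      refine le_of_tendsto_of_tendsto hcl hcr ?_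
      filter_upwards [Ioo_mem_nhdsLT hst] with u hu
      exact hinter s u hs hu.1 hu.2 (by linarith [hu.2])
  intro s hs t ht h0 h1
  rcases lt_trichotomy s t with h | h | h
  · have e : |s - t| = t - s := by rw [abs_sub_comm, abs_of_pos (sub_pos.2 h)]
    rw [e] at h1 ⊢
    rw [abs_sub_comm]
    exact hall s t hs.1 h ht.2 h1
  · simp [h] at h0
  · have e : |s - t| = s - t := abs_of_pos (sub_pos.2 h)
    rw [e] at h1 ⊢
    exact hall t s ht.1 h hs.2 h1
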